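/- There exist an effectively computable constant a₀ > 0 and T₀ > 0 such that for every real T ≥ T₀ the following holds. Let Z_T be the set of all zeros ρ = β + iγ with 0 < β < 1 and |γ| ≤ T of the Dirichlet L-functions L(s,χ) taken over all primitive Dirichlet characters χ of modulus q ≤ T. Suppose there is a real zero β_T ∈ Z_T with β_T ≥ 1 − a₀/log T (the T-exceptional zero, belonging to a real primitive character χ_T). Then every zero ρ = β + iγ in Z_T with ρ ≠ β_T satisfies β ≤ 1 − (a₀/log T) · log( a₀ e / ((1 − β_T) log T) ). -/

import Mathlib

section ZerosInDisc

open Metric ComplexConjugate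

theorem exists_blaschke_factor {f : ℂ → ℂ} (hf : Differentiable ℂ f) {R M : ℝ} (hR : 0 < R)
    (hM : ∀ s, ‖s‖ ≤ R → ‖f s‖ ≤ M) {ρ : ℂ} (hρ : ‖ρ‖ < R) (hfρ : f ρ = 0) :
    ∃ g : ℂ → ℂ, Differentiable ℂ g ∧ (∀ s, ‖s‖ ≤ R → ‖g s‖ ≤ M) ∧
      ∀ s, f s * ((R ^ 2 - s * conj ρ) / R) = (s - ρ) * g s := by
  have hR' : (R : ℂ) ≠ 0 := by exact_mod_cast hR.ne'
  have hd : Differentiable ℂ (dslope f ρ) := by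
    rw [← differentiableOn_univ]
    exact (Complex.differentiableOn_dslope Filter.univ_mem).2 hf.differentiableOn
  have hdiff : Differentiable ℂ (fun s => dslope f ρ s * ((R ^ 2 - s * conj ρ) / R)) := by
    fun_prop
  have key : ∀ s, f s * ((R ^ 2 - s * conj ρ) / R) =
      (s - ρ) * (dslope f ρ s * ((R ^ 2 - s * conj ρ) / R)) := by
    intro s
    have := sub_smul_dslope f ρ s
    rw [hfρ, sub_zero, smul_eq_mul] at this
    rw [← mul_assoc, this]
  refine ⟨_, hdiff, ?_, key⟩
  intro s hs
  have hcl : s ∈ closure (ball (0 : ℂ) R) := by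
    rw [closure_ball _ hR.ne']; simpa using hs
  refine Complex.norm_le_of_forall_mem_frontier_norm_le isBounded_ball
    hdiff.diffContOnCl (fun z hz => ?_) hcl
  rw [frontier_ball _ hR.ne', mem_sphere_zero_iff_norm] at hz
  have hzρ : z - ρ ≠ 0 := by
    intro h
    rw [sub_eq_zero] at h
    rw [h] at hz; linarith
  have h1 : ‖((R : ℂ) ^ 2 - z * conj ρ) / R‖ = ‖z - ρ‖ := by
    have : (R : ℂ) ^ 2 - z * conj ρ = z * conj (z - ρ) := by
      rw [map_sub, mul_sub, Complex.mul_conj, Complex.normSq_eq_norm_sq, hz]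
      push_cast; ring
    rw [this, norm_div, norm_mul, RCLike.norm_conj, hz, Complex.norm_real, Real.norm_of_nonneg hR.le]
    field_simp
  have h2 := congrArg norm (key z)
  rw [norm_mul, h1, norm_mul, mul_comm] at h2
  have h3 := mul_left_cancel₀ (norm_ne_zero_iff.2 hzρ) h2
  rw [← h3]
  exact hM z hz.le

theorem exists_blaschke_decomposition {R R₁ M : ℝ} (h₁ : 0 < R₁) (h : R₁ < R) (n : ℕ) :
    ∀ f : ℂ → ℂ, Differentiable ℂ f → (∀ s, ‖s‖ ≤ R → ‖f s‖ ≤ M) → f 0 ≠ 0 →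
      M < ‖f 0‖ * (R / R₁) ^ n →
      ∃ (Z : Multiset ℂ) (g : ℂ → ℂ), Differentiable ℂ g ∧ (∀ s, ‖s‖ ≤ R → ‖g s‖ ≤ M) ∧
        (∀ s, ‖s‖ ≤ R₁ → g s ≠ 0) ∧ ‖f 0‖ * (R / R₁) ^ Z.card ≤ ‖g 0‖ ∧
        (∀ z ∈ Z, z ≠ 0 ∧ ‖z‖ ≤ R₁) ∧ (∀ z, ‖z‖ ≤ R₁ → f z = 0 → z ∈ Z) ∧
        ∀ s, ‖s‖ ≤ R₁ → f s ≠ 0 → logDeriv f s = logDeriv g s +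
          (Z.map fun z => 1 / (s - z) + conj z / (R ^ 2 - s * conj z)).sum := by
  have hR : 0 < R := h₁.trans h
  have hR' : (R : ℂ) ≠ 0 := by exact_mod_cast hR.ne'
  induction n with
  | zero =>
    intro f hf hM h0 hlt
    exact absurd (hM 0 (by simpa using hR.le)) (by simpa using hlt)
  | succ n ih =>
    intro f hf hM h0 hlt
    by_cases hz : ∃ ρ, ‖ρ‖ ≤ R₁ ∧ f ρ = 0
    · obtain ⟨ρ, hρ, hfρ⟩ := hz
      have hρ0 : ρ ≠ 0 := by rintro rfl; exact h0 hfρ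
      obtain ⟨g, hg, hgM, hfg⟩ := exists_blaschke_factor hf hR hM (hρ.trans_lt h) hfρ
      have hg0 : ‖g 0‖ = ‖f 0‖ * (R / ‖ρ‖) := by
        have h2 := congrArg norm (hfg 0)
        have hn : ‖ρ‖ ≠ 0 := norm_ne_zero_iff.2 hρ0
        simp only [zero_mul, sub_zero, zero_sub, norm_mul, norm_neg, norm_div, norm_pow,
          Complex.norm_real, Real.norm_of_nonneg hR.le] at h2
        field_simp at h2 ⊢
        linarith
      have hg0' : ‖f 0‖ * (R / R₁) ≤ ‖g 0‖ := by
        rw [hg0]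
        have : 0 < ‖ρ‖ := norm_pos_iff.2 hρ0
        gcongr
      have hgne : g 0 ≠ 0 := by
        rw [← norm_pos_iff]
        exact lt_of_lt_of_le (mul_pos (norm_pos_iff.2 h0) (div_pos hR h₁)) hg0'
      have hq : 0 < R / R₁ := div_pos hR h₁
      obtain ⟨Z, k, hk, hkM, hkne, hkc, hZ, hmem, hlog⟩ := ih g hg hgM hgne (by
        refine hlt.trans_le ?_
        rw [pow_succ', ← mul_assoc]
        gcongr)
      refine ⟨ρ ::ₘ Z, k, hk, hkM, hkne, ?_, ?_, ?_, ?_⟩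
      · rw [Multiset.card_cons, pow_succ', ← mul_assoc]
        refine le_trans ?_ hkc
        gcongr
      · intro z hz
        rcases Multiset.mem_cons.1 hz with rfl | hz
        · exact ⟨hρ0, hρ⟩
        · exact hZ z hz
      · intro z hz hfz
        rw [Multiset.mem_cons]
        have := hfg z
        rw [hfz, zero_mul, eq_comm, mul_eq_zero, sub_eq_zero] at this
        exact this.imp id (hmem z hz)
      · intro s hs hfs
        have hne : (R : ℂ) ^ 2 - s * conj ρ ≠ 0 := by
          intro h'
          have h2 := congrArg norm (sub_eq_zero.1 h')
          simp only [norm_mul, norm_pow, Complex.norm_real, Real.norm_of_nonneg hR.le,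
            RCLike.norm_conj] at h2
          have : ‖s‖ * ‖ρ‖ ≤ R₁ * R₁ := by gcongr
          nlinarith
        have hL : f s * ((R ^ 2 - s * conj ρ) / R) ≠ 0 := mul_ne_zero hfs (div_ne_zero hne hR')
        have hRne : (s - ρ) * g s ≠ 0 := by rw [← hfg]; exact hL
        have hgs := right_ne_zero_of_mul hRne
        have hsρ := left_ne_zero_of_mul hRne
        have e1 : logDeriv (fun s => f s * ((R ^ 2 - s * conj ρ) / R)) s =
            logDeriv f s + -conj ρ / (R ^ 2 - s * conj ρ) := by
          rw [logDeriv_mul (g := fun s : ℂ => ((R : ℂ) ^ 2 - s * conj ρ) / R) s hfs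
            (div_ne_zero hne hR') hf.differentiableAt (by fun_prop)]
          congr 1
          have hd : HasDerivAt (fun s : ℂ => ((R : ℂ) ^ 2 - s * conj ρ) / R) ((- (1 * conj ρ)) / R) s :=
            (((hasDerivAt_id s).mul_const (conj ρ)).const_sub _).div_const _
          rw [logDeriv_apply, hd.deriv]
          field_simp
        have e2 : logDeriv (fun s => (s - ρ) * g s) s = 1 / (s - ρ) + logDeriv g s := by
          rw [logDeriv_mul s hsρ hgs (by fun_prop) hg.differentiableAt]
          congr 1
          rw [logDeriv_apply, deriv_sub_const, deriv_id'']
        have e3 : (fun s => f s * ((R ^ 2 - s * conj ρ) / R)) = fun s => (s - ρ) * g s :=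
          funext hfg
        rw [e3, e2, hlog s hs hgs] at e1
        rw [Multiset.map_cons, Multiset.sum_cons]
        linear_combination -e1
    · push Not at hz
      exact ⟨0, f, hf, hM, hz, by simp, by simp, fun z h h' => absurd h' (hz z h), by simp⟩

theorem norm_logDeriv_le_of_ne_zero {g : ℂ → ℂ} (hg : Differentiable ℂ g) {m r₁ r₂ r₃ : ℝ}
    (hm : 0 < m) (h₃ : 0 < r₃) (h₂ : r₃ < r₂) (h₁ : r₂ < r₁)
    (hne : ∀ s, ‖s‖ < r₁ → g s ≠ 0) (hb : ∀ s, ‖s‖ < r₁ → ‖g s‖ ≤ Real.exp m * ‖g 0‖)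
    {s : ℂ} (hs : ‖s‖ ≤ r₃) : ‖logDeriv g s‖ ≤ 2 * m * r₂ / (r₁ - r₂) / (r₂ - r₃) := by
  have h0 : 0 < r₁ := by linarith
  have hd : DifferentiableOn ℂ (logDeriv g) (ball 0 r₁) := by
    intro z hz
    have : DifferentiableAt ℂ (deriv g) z := (hg.analyticAt z).deriv.differentiableAt
    exact (this.div (hg z) (hne z (by simpa using hz))).differentiableWithinAt
  obtain ⟨h, hh0, hh⟩ := (hd.isExactOn_ball).with_val_at 0 0
  have hdiff : DifferentiableOn ℂ h (ball 0 r₁) := fun z hz =>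
    (hh z hz).differentiableAt.differentiableWithinAt
  have hconst : ∀ z ∈ ball (0 : ℂ) r₁, g z * Complex.exp (-h z) = g 0 := by
    intro z hz
    have h0m : (0 : ℂ) ∈ ball (0 : ℂ) r₁ := by simpa using h0
    have hD : ∀ w ∈ ball (0 : ℂ) r₁, HasDerivAt (fun w => g w * Complex.exp (-h w)) 0 w := by
      intro w hw
      have hw0 := hne w (by simpa using hw)
      refine ((hg w).hasDerivAt.mul (hh w hw).neg.cexp).congr_deriv ?_
      rw [logDeriv_apply, Pi.neg_apply]; field_simp; ring
    have := (convex_ball (0 : ℂ) r₁).is_const_of_fderivWithin_eq_zero (𝕜 := ℂ)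
      (f := fun w => g w * Complex.exp (-h w))
      (fun w hw => (hD w hw).differentiableAt.differentiableWithinAt) (fun w hw => by
        rw [fderivWithin_of_isOpen isOpen_ball hw]
        ext
        simp [(hD w hw).deriv]) hz h0m
    simpa [hh0] using this
  have hre : Set.MapsTo h (ball 0 r₁) {z | z.re ≤ m} := by
    intro z hz
    have h1 := congrArg norm (hconst z hz)
    have h2 := hb z (by simpa using hz)
    have hg0 : 0 < ‖g 0‖ := norm_pos_iff.2 (hne 0 (by simpa using h0))
    rw [norm_mul, Complex.norm_exp, Complex.neg_re, Real.exp_neg] at h1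
    have h3 : ‖g z‖ = ‖g 0‖ * Real.exp (h z).re := by
      rw [← h1]; field_simp
    rw [h3, mul_comm] at h2
    exact Real.exp_le_exp.1 (le_of_mul_le_mul_right h2 hg0)
  have hsm : s ∈ ball (0 : ℂ) r₁ := by
    rw [mem_ball_zero_iff]; linarith
  rw [← (hh s hsm).deriv]
  refine Complex.norm_deriv_le_of_forall_mem_sphere_norm_le (by linarith) ?_ ?_
  · refine hdiff.diffContOnCl_ball fun z hz => ?_
    have := mem_closedBall_iff_norm.1 hz
    rw [mem_ball_zero_iff]
    calc ‖z‖ = ‖s + (z - s)‖ := by ring_nf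
      _ ≤ ‖s‖ + ‖z - s‖ := norm_add_le _ _
      _ < r₁ := by linarith
  · intro z hz
    have hz2 : ‖z‖ ≤ r₂ := by
      have := mem_sphere_iff_norm.1 hz
      calc ‖z‖ = ‖s + (z - s)‖ := by ring_nf
        _ ≤ ‖s‖ + ‖z - s‖ := norm_add_le _ _
        _ ≤ r₂ := by linarith
    have := Complex.borelCaratheodory_zero hm hdiff hre h0 (z := z)
      (by rw [mem_ball_zero_iff]; linarith) hh0
    refine this.trans ?_
    have : 0 < r₁ - r₂ := by linarith
    have : 0 < r₂ := by linarith
    gcongr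

theorem differentiableAt_multiset_sum_map {ι : Type*} (Z : Multiset ι) {F : ι → ℂ → ℂ} {s : ℂ}
    (h : ∀ z ∈ Z, DifferentiableAt ℂ (F z) s) :
    DifferentiableAt ℂ (fun s => (Z.map fun z => F z s).sum) s := by
  induction Z using Multiset.induction with
  | empty => simp
  | cons a Z ih =>
    simp only [Multiset.map_cons, Multiset.sum_cons]
    exact (h a (Multiset.mem_cons_self a Z)).add
      (ih fun z hz => h z (Multiset.mem_cons_of_mem hz))

theorem norm_multiset_sum_map_le {ι : Type*} (Z : Multiset ι) {F : ι → ℂ} {C : ℝ}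
    (h : ∀ z ∈ Z, ‖F z‖ ≤ C) : ‖(Z.map F).sum‖ ≤ Z.card * C := by
  induction Z using Multiset.induction with
  | empty => simp
  | cons a Z ih =>
    simp only [Multiset.map_cons, Multiset.sum_cons, Multiset.card_cons]
    push_cast
    have h1 := h a (Multiset.mem_cons_self a Z)
    have h2 := ih fun z hz => h z (Multiset.mem_cons_of_mem hz)
    calc _ ≤ ‖F a‖ + ‖(Z.map F).sum‖ := norm_add_le _ _
      _ ≤ _ := by linarith

theorem iteratedDeriv_multiset_sum_inv_sub (Z : Multiset ℂ) (h : ∀ z ∈ Z, z ≠ 0) (n : ℕ) :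
    AnalyticAt ℂ (fun s => (Z.map fun z => (s - z)⁻¹).sum) 0 ∧
    (-1) ^ n / (n.factorial : ℂ) * iteratedDeriv n (fun s => (Z.map fun z => (s - z)⁻¹).sum) 0 =
      (Z.map fun z => (-z⁻¹) ^ (n + 1)).sum := by
  induction Z using Multiset.induction with
  | empty => simp [analyticAt_const]
  | cons a Z ih =>
    simp only [Multiset.map_cons, Multiset.sum_cons]
    have ha : a ≠ 0 := h a (Multiset.mem_cons_self a Z)
    have hA : AnalyticAt ℂ (fun s : ℂ => (s - a)⁻¹) 0 := by
      refine AnalyticAt.inv (by fun_prop) ?_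
      simpa using ha
    obtain ⟨h1, h2⟩ := ih fun z hz => h z (Multiset.mem_cons_of_mem hz)
    refine ⟨hA.add h1, ?_⟩
    have := iteratedDeriv_add (n := n) hA.contDiffAt h1.contDiffAt
    simp only [Pi.add_def] at this
    rw [this, mul_add, h2]
    congr 1
    have h3 := congrFun (iter_deriv_inv_linear_sub n 1 a) 0
    simp only [one_mul, one_pow, mul_one, zero_sub] at h3
    rw [iteratedDeriv_eq_iterate, h3]
    have hf : (n.factorial : ℂ) ≠ 0 := by exact_mod_cast n.factorial_ne_zero
    have e : ((-1 : ℤ) - n) = -((n + 1 : ℕ) : ℤ) := by push_cast; ring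
    rw [e, zpow_neg, zpow_natCast, ← inv_pow, inv_neg]
    field_simp
    rw [← pow_mul, mul_comm n 2, pow_mul]; simp

theorem exists_approx_iteratedDeriv_logDeriv {f : ℂ → ℂ} (hf : Differentiable ℂ f) (h0 : f 0 ≠ 0)
    {m : ℝ} (hm : 0 < m) (hb : ∀ s, ‖s‖ ≤ 9 / 5 → ‖f s‖ ≤ Real.exp m * ‖f 0‖) :
    ∃ W : Multiset ℂ, (W.card : ℝ) ≤ 18 * m ∧
      (∀ z, ‖z‖ ≤ 17 / 10 → f z = 0 → -z⁻¹ ∈ W) ∧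
      ∀ n : ℕ, ‖(-1) ^ n / (n.factorial : ℂ) * iteratedDeriv n (logDeriv f) 0 -
        (W.map (· ^ (n + 1))).sum‖ ≤ 1400 * m * (5 / 8) ^ n := by
  have hf0 : 0 < ‖f 0‖ := norm_pos_iff.2 h0
  have hlog : (1 : ℝ) / 18 ≤ Real.log ((9 / 5) / (17 / 10)) := by
    have := Real.one_sub_inv_le_log_of_pos (x := (9 / 5 : ℝ) / (17 / 10)) (by norm_num)
    norm_num at this ⊢; linarith
  obtain ⟨n, hn⟩ := pow_unbounded_of_one_lt (Real.exp m) (show (1 : ℝ) < (9 / 5) / (17 / 10) by norm_num)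
  obtain ⟨Z, g, hg, hgb, hgne, hgc, hZ, hmem, hfg⟩ := exists_blaschke_decomposition
    (R := 9 / 5) (R₁ := 17 / 10) (M := Real.exp m * ‖f 0‖) (by norm_num) (by norm_num) n f hf hb h0
    (by rw [mul_comm]; gcongr)
  have hcard : (Z.card : ℝ) ≤ 18 * m := by
    have h1 := hgc.trans (hgb 0 (by norm_num))
    rw [mul_comm] at h1
    have h2 := Real.log_le_log (by positivity) (le_of_mul_le_mul_right h1 hf0)
    rw [Real.log_exp, Real.log_pow] at h2
    have h3 : (Z.card : ℝ) * (1 / 18) ≤ Z.card * Real.log ((9 / 5) / (17 / 10)) := by gcongr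
    linarith
  have hg0 : ‖f 0‖ ≤ ‖g 0‖ := by
    refine le_trans ?_ hgc
    exact le_mul_of_one_le_right hf0.le (one_le_pow₀ (by norm_num))
  have hgb' : ∀ s, ‖s‖ ≤ 9 / 5 → ‖g s‖ ≤ Real.exp m * ‖g 0‖ := fun s hs =>
    (hgb s hs).trans (by gcongr)
  have hden : ∀ z ∈ Z, ∀ s : ℂ, ‖s‖ < 17 / 10 → (9 / 5 : ℂ) ^ 2 - s * conj z ≠ 0 := by
    intro z hz s hs h
    have h2 := congrArg norm (sub_eq_zero.1 h)
    have : ‖s‖ * ‖z‖ ≤ 17 / 10 * (17 / 10) := by gcongr; exact (hZ z hz).2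
    simp only [norm_mul, RCLike.norm_conj] at h2
    norm_num at h2
    linarith
  set E : ℂ → ℂ := fun s => logDeriv g s +
    (Z.map fun z => conj z / ((9 / 5 : ℂ) ^ 2 - s * conj z)).sum with hE
  have hEd : DifferentiableOn ℂ E (ball 0 (17 / 10)) := by
    intro s hs
    rw [mem_ball_zero_iff] at hs
    refine DifferentiableAt.differentiableWithinAt ?_
    refine DifferentiableAt.add ?_ ?_
    · exact ((hg.analyticAt s).deriv.differentiableAt).div (hg s) (hgne s hs.le)
    · refine differentiableAt_multiset_sum_map Z (F := fun z s =>
        conj z / ((9 / 5 : ℂ) ^ 2 - s * conj z)) fun z hz => ?_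
      exact DifferentiableAt.div (by fun_prop) (by fun_prop) (hden z hz s hs)
  have hEb : ∀ s, ‖s‖ ≤ 8 / 5 → ‖E s‖ ≤ 1400 * m := by
    intro s hs
    have h1 := norm_logDeriv_le_of_ne_zero hg hm (r₁ := 17 / 10) (r₂ := 33 / 20) (r₃ := 8 / 5)
      (by norm_num) (by norm_num) (by norm_num) (fun s hs => hgne s hs.le)
      (fun s hs => hgb' s (by linarith)) hs
    have h2 := norm_multiset_sum_map_le Z (F := fun z => conj z / ((9 / 5 : ℂ) ^ 2 - s * conj z))
      (C := 4) fun z hz => by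
        have hz2 := (hZ z hz).2
        have h3 : ‖s‖ * ‖z‖ ≤ 8 / 5 * (17 / 10) := by gcongr
        have h4 : (9 / 5 : ℝ) ^ 2 - 8 / 5 * (17 / 10) ≤ ‖(9 / 5 : ℂ) ^ 2 - s * conj z‖ := by
          refine le_trans ?_ (norm_sub_norm_le _ _)
          simp only [norm_mul, RCLike.norm_conj]
          norm_num
          linarith
        rw [norm_div, RCLike.norm_conj, div_le_iff₀ (by linarith)]
        linarith
    calc ‖E s‖ ≤ _ := norm_add_le _ _
      _ ≤ 1400 * m := by
        norm_num at h1
        linarith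
  have hsplit : logDeriv f =ᶠ[nhds 0] fun s => (Z.map fun z => (s - z)⁻¹).sum + E s := by
    filter_upwards [hf.continuous.continuousAt.eventually_ne h0,
      ball_mem_nhds (0 : ℂ) (show (0 : ℝ) < 17 / 10 by norm_num)] with s hs hs'
    rw [mem_ball_zero_iff] at hs'
    rw [hfg s hs'.le hs, hE]
    simp only [Multiset.sum_map_add, one_div]
    push_cast
    ring
  have hEan : AnalyticAt ℂ E 0 :=
    hEd.analyticAt (isOpen_ball.mem_nhds (by simp))
  refine ⟨Z.map fun z => -z⁻¹, by simpa using hcard,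
    fun z hz hfz => Multiset.mem_map_of_mem _ (hmem z hz hfz), fun n => ?_⟩
  obtain ⟨hA, hS⟩ := iteratedDeriv_multiset_sum_inv_sub Z (fun z hz => (hZ z hz).1) n
  have hadd := iteratedDeriv_add (n := n) hA.contDiffAt hEan.contDiffAt
  simp only [Pi.add_def] at hadd
  rw [hsplit.iteratedDeriv_eq n, hadd, mul_add, hS, Multiset.map_map]
  simp only [Function.comp_def, add_sub_cancel_left]
  have hC := Complex.norm_iteratedDeriv_le_of_forall_mem_sphere_norm_le (C := 1400 * m)
    (R := 8 / 5) (c := 0) (f := E) n (by norm_num)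
    (hEd.diffContOnCl_ball (closedBall_subset_ball (by norm_num)))
    (fun z hz => hEb z (by simpa using (mem_sphere_zero_iff_norm.1 hz).le))
  have hf' : (0 : ℝ) < n.factorial := by exact_mod_cast n.factorial_pos
  rw [norm_mul, norm_div, norm_pow, norm_neg, norm_one, one_pow, Complex.norm_natCast]
  calc 1 / (n.factorial : ℝ) * ‖iteratedDeriv n E 0‖
      ≤ 1 / (n.factorial : ℝ) * (n.factorial * (1400 * m) / (8 / 5) ^ n) := by gcongr
    _ = 1400 * m * (5 / 8) ^ n := by
      rw [show (5 / 8 : ℝ) = (8 / 5)⁻¹ by norm_num, inv_pow]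
      field_simp

theorem normSq_geom_sum_eq {z : ℂ} (hz : ‖z‖ = 1) (J : ℕ) :
    ‖∑ k ∈ Finset.range (J + 1), z ^ k‖ ^ 2 =
      (J + 1 : ℝ) + 2 * (∑ i ∈ Finset.range J, ((J : ℂ) - i) * z ^ (i + 1)).re := by
  induction J with
  | zero => simp
  | succ J ih =>
    have h1 : ∑ k ∈ Finset.range (J + 1 + 1), z ^ k =
        z * ∑ k ∈ Finset.range (J + 1), z ^ k + 1 := by
      rw [Finset.sum_range_succ', Finset.mul_sum]
      simp [pow_succ']
    have h2 : ∑ i ∈ Finset.range (J + 1), (((J + 1 : ℕ) : ℂ) - i) * z ^ (i + 1) =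
        ∑ i ∈ Finset.range J, ((J : ℂ) - i) * z ^ (i + 1) +
          z * ∑ k ∈ Finset.range (J + 1), z ^ k := by
      rw [Finset.mul_sum, Finset.sum_range_succ, Finset.sum_range_succ, ← add_assoc,
        ← Finset.sum_add_distrib]
      congr 1
      · refine Finset.sum_congr rfl fun i _ => ?_
        push_cast; ring
      · push_cast; ring
    rw [h1, h2, Complex.add_re]
    have h3 : ∀ w : ℂ, ‖w + 1‖ ^ 2 = ‖w‖ ^ 2 + 2 * w.re + 1 := by
      intro w
      rw [← Complex.normSq_eq_norm_sq, ← Complex.normSq_eq_norm_sq, Complex.normSq_apply,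
        Complex.normSq_apply]
      simp; ring
    rw [h3, norm_mul, hz, one_mul, ih]
    push_cast; ring

theorem neg_half_le_re_fejer_sum (J : ℕ) {z : ℂ} (hz : ‖z‖ ≤ 1) :
    -(1 / 2 : ℝ) ≤ (∑ i ∈ Finset.range J, (((J : ℂ) - i) / (J + 1)) * z ^ (i + 1)).re := by
  set P : ℂ → ℂ := fun z => ∑ i ∈ Finset.range J, (((J : ℂ) - i) / (J + 1)) * z ^ (i + 1) with hP
  have hPd : Differentiable ℂ P := by
    rw [hP]; fun_prop
  have hsph : ∀ w : ℂ, ‖w‖ = 1 → -(1 / 2 : ℝ) ≤ (P w).re := by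
    intro w hw
    have h := normSq_geom_sum_eq hw J
    have e : P w = ((1 / (J + 1 : ℝ) : ℝ) : ℂ) *
        ∑ i ∈ Finset.range J, ((J : ℂ) - i) * w ^ (i + 1) := by
      rw [hP, Finset.mul_sum]
      refine Finset.sum_congr rfl fun i _ => ?_
      push_cast; ring
    rw [e, Complex.re_ofReal_mul]
    have h2 : 0 ≤ ‖∑ k ∈ Finset.range (J + 1), w ^ k‖ ^ 2 := by positivity
    have h3 : (0 : ℝ) < J + 1 := by positivity
    rw [div_mul_eq_mul_div, one_mul, le_div_iff₀ h3]
    linarith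
  have hbd : ‖Complex.exp (-P z)‖ ≤ Real.exp (1 / 2) := by
    refine Complex.norm_le_of_forall_mem_frontier_norm_le (U := ball 0 1) isBounded_ball
      (f := fun z => Complex.exp (-P z)) (hPd.neg.cexp).diffContOnCl (fun w hw => ?_) ?_
    · rw [frontier_ball _ one_ne_zero, mem_sphere_zero_iff_norm] at hw
      rw [Complex.norm_exp, Real.exp_le_exp, Complex.neg_re]
      linarith [hsph w hw]
    · rw [closure_ball _ one_ne_zero]; simpa using hz
  rw [Complex.norm_exp, Real.exp_le_exp, Complex.neg_re] at hbd
  linarith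

theorem exists_weights_power_sum_lower_bound (W : Multiset ℂ) (hW : ∀ w ∈ W, ‖w‖ ≤ 1) {u : ℂ}
    (hu : u ∈ W) (hu1 : ‖u‖ = 1) (J : ℕ) :
    ∃ a : ℕ → ℝ, (∀ i ∈ Finset.range J, 0 ≤ a i ∧ a i ≤ 2) ∧
      (J : ℝ) / 4 - W.card ≤
        ∑ i ∈ Finset.range J, a i * ((W.map fun w => w ^ (i + 1)).sum).re := by
  set F : ℂ → ℂ := fun z => ∑ i ∈ Finset.range J, (((J : ℂ) - i) / (J + 1)) * z ^ (i + 1) with hF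
  set a : ℕ → ℝ := fun i => ((J : ℝ) - i) / (J + 1) * (1 + (u ^ (i + 1)).re) with ha
  have hJ : (0 : ℝ) < J + 1 := by positivity
  have key : ∀ w : ℂ, ∑ i ∈ Finset.range J, a i * (w ^ (i + 1)).re =
      (F w).re + (F (w * u)).re / 2 + (F (w * conj u)).re / 2 := by
    intro w
    simp only [hF, Complex.re_sum, Finset.sum_div, ← Finset.sum_add_distrib]
    refine Finset.sum_congr rfl fun i _ => ?_
    have e : (((J : ℂ) - i) / (J + 1)) = (((((J : ℝ) - i) / (J + 1)) : ℝ) : ℂ) := by push_cast; rfl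
    rw [e, Complex.re_ofReal_mul, Complex.re_ofReal_mul, Complex.re_ofReal_mul, mul_pow, mul_pow,
      ← map_pow, Complex.mul_re, Complex.mul_re, Complex.conj_re, Complex.conj_im, ha]
    ring
  have hlow : ∀ w : ℂ, ‖w‖ ≤ 1 → -1 ≤ ∑ i ∈ Finset.range J, a i * (w ^ (i + 1)).re := by
    intro w hw
    rw [key]
    have h1 := neg_half_le_re_fejer_sum J hw
    have h2 := neg_half_le_re_fejer_sum J (z := w * u) (by rw [norm_mul, hu1, mul_one]; exact hw)
    have h3 := neg_half_le_re_fejer_sum J (z := w * conj u)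
      (by rw [norm_mul, RCLike.norm_conj, hu1, mul_one]; exact hw)
    simp only [hF]
    linarith
  have hone : (F 1).re = J / 2 := by
    have h := normSq_geom_sum_eq (z := 1) (by simp) J
    have e : F 1 = ((1 / (J + 1 : ℝ) : ℝ) : ℂ) *
        ∑ i ∈ Finset.range J, ((J : ℂ) - i) * 1 ^ (i + 1) := by
      rw [hF, Finset.mul_sum]
      refine Finset.sum_congr rfl fun i _ => ?_
      push_cast; ring
    rw [e, Complex.re_ofReal_mul]
    simp only [one_pow, Finset.sum_const, Finset.card_range, nsmul_eq_mul, mul_one] at h ⊢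
    have h4 : ‖((J + 1 : ℕ) : ℂ)‖ = J + 1 := by
      rw [Complex.norm_natCast]; push_cast; rfl
    rw [h4] at h
    field_simp
    nlinarith
  have hmain : (J : ℝ) / 4 - 1 ≤ ∑ i ∈ Finset.range J, a i * (u ^ (i + 1)).re := by
    rw [key]
    have h1 := neg_half_le_re_fejer_sum J hu1.le
    have h2 := neg_half_le_re_fejer_sum J (z := u * u) (by rw [norm_mul, hu1, mul_one])
    have h3 : u * conj u = 1 := by
      rw [Complex.mul_conj, Complex.normSq_eq_norm_sq, hu1]; simp
    rw [h3, hone]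
    simp only [hF]
    linarith
  refine ⟨a, fun i hi => ?_, ?_⟩
  · have hi' : (i : ℝ) ≤ J := by exact_mod_cast (Finset.mem_range.1 hi).le
    have h1 : |(u ^ (i + 1)).re| ≤ 1 := by
      refine (Complex.abs_re_le_norm _).trans ?_
      rw [norm_pow, hu1, one_pow]
    rw [abs_le] at h1
    have h2 : 0 ≤ ((J : ℝ) - i) / (J + 1) := div_nonneg (by linarith) hJ.le
    have h3 : ((J : ℝ) - i) / (J + 1) ≤ 1 := by
      rw [div_le_one hJ]
      have : (0 : ℝ) ≤ i := by positivity
      linarith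
    simp only [ha]
    constructor
    · exact mul_nonneg h2 (by linarith)
    · nlinarith
  · obtain ⟨V, rfl⟩ := Multiset.exists_cons_of_mem hu
    have hV : ∀ V : Multiset ℂ, (∀ w ∈ V, ‖w‖ ≤ 1) →
        -(V.card : ℝ) ≤ ∑ i ∈ Finset.range J, a i * ((V.map fun w => w ^ (i + 1)).sum).re := by
      intro V
      induction V using Multiset.induction with
      | empty => simp
      | cons b V ih =>
        intro hV
        simp only [Multiset.map_cons, Multiset.sum_cons, Complex.add_re, mul_add,
          Finset.sum_add_distrib, Multiset.card_cons]
        have h1 := hlow b (hV b (Multiset.mem_cons_self b V))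
        have h2 := ih fun z hz => hV z (Multiset.mem_cons_of_mem hz)
        push_cast
        linarith
    have := hV V fun w hw => hW w (Multiset.mem_cons_of_mem hw)
    simp only [Multiset.map_cons, Multiset.sum_cons, Complex.add_re, mul_add,
      Finset.sum_add_distrib, Multiset.card_cons]
    push_cast
    linarith

end ZerosInDisc

open Complex Filter Topology MeasureTheory Set in
theorem LSeries_exists_analytic_remainder {a : ℕ → ℂ} {κ : ℂ} {B : ℝ}
    (ha : ∀ s : ℂ, 1 < s.re → LSeriesSummable a s)
    (hB : ∀ t : ℝ, 1 ≤ t → ‖∑ k ∈ Finset.Icc 1 ⌊t⌋₊, a k - κ * t‖ ≤ B) :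
    ∃ I : ℂ → ℂ, (∀ s, 0 < s.re → DifferentiableAt ℂ I s) ∧ (∀ s, 0 < s.re → ‖I s‖ ≤ B / s.re) ∧
      ∀ s, 1 < s.re → LSeries a s = s * I s + κ * s / (s - 1) := by
  set E : ℝ → ℂ := fun t => ∑ k ∈ Finset.Icc 1 ⌊t⌋₊, a k - κ * t with hE
  have hS : Measurable fun t : ℝ => ∑ k ∈ Finset.Icc 1 ⌊t⌋₊, a k :=
    (measurable_from_top (f := fun n : ℕ => ∑ k ∈ Finset.Icc 1 n, a k)).comp Nat.measurable_floor
  have hEm : Measurable E := by fun_prop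
  have hB0 : 0 ≤ B := (norm_nonneg _).trans (hB 1 le_rfl)
  set F : ℝ → ℂ := indicator (Ioi 1) E with hF
  have hFm : Measurable F := hEm.indicator measurableSet_Ioi
  have hFB (t : ℝ) : ‖F t‖ ≤ B := by
    rw [hF, indicator]
    split_ifs with h
    · exact hB t (le_of_lt h)
    · simpa
  have hI (s : ℂ) : mellin F (-s) = ∫ t in Ioi (1 : ℝ), E t * (t : ℂ) ^ (-(s + 1)) := by
    rw [mellin, ← integral_indicator measurableSet_Ioi, ← integral_indicator measurableSet_Ioi]
    congr 1
    ext t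
    by_cases h1 : 1 < t
    · have h0 : 0 < t := by linarith
      simp only [mem_Ioi, h0, h1, indicator_of_mem, hF, smul_eq_mul]
      rw [mul_comm]
      congr 2
      ring
    · simp [hF, indicator, h1]
  have hintegrable (s : ℂ) (hs : 0 < s.re) :
      IntegrableOn (fun t : ℝ => E t * (t : ℂ) ^ (-(s + 1))) (Ioi 1) := by
    have h1 : IntegrableOn (fun t : ℝ => (t : ℂ) ^ (-(s + 1))) (Ioi 1) :=
      integrableOn_Ioi_cpow_of_lt (by simpa using hs) one_pos
    refine Integrable.bdd_mul (c := B) h1 hEm.aestronglyMeasurable ?_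
    filter_upwards [ae_restrict_mem measurableSet_Ioi] with t ht using hB t (le_of_lt ht)
  refine ⟨fun s => mellin F (-s), fun s hs => ?_, fun s hs => ?_, fun s hs => ?_⟩
  · have hd : DifferentiableAt ℂ (mellin F) (-s) := by
      refine mellin_differentiableAt_of_isBigO_rpow (a := 0) (b := -s.re - 1) ?_ ?_ (by simpa) ?_
        (by simp)
      · refine LocallyIntegrable.locallyIntegrableOn (fun x => ?_) _
        refine ⟨Icc (x - 1) (x + 1), Icc_mem_nhds (sub_one_lt x) (lt_add_one x), ?_⟩
        exact Measure.integrableOn_of_bounded (M := B) (by simp) hFm.aestronglyMeasurable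
          (ae_of_all _ hFB)
      · refine Asymptotics.IsBigO.of_bound B (Eventually.of_forall fun t => ?_)
        simpa using hFB t
      · refine Asymptotics.IsBigO.of_bound 0 ?_
        have : ∀ᶠ t : ℝ in 𝓝[>] 0, t < 1 :=
          (eventually_lt_nhds one_pos).filter_mono nhdsWithin_le_nhds
        filter_upwards [this] with t ht
        simp [hF, not_lt.2 ht.le]
    exact hd.comp s differentiableAt_id.neg
  · beta_reduce
    rw [hI]
    have h1 : ∫ t in Ioi (1 : ℝ), B * t ^ (-s.re - 1) = B / s.re := by
      rw [integral_const_mul, integral_Ioi_rpow_of_lt (by linarith) one_pos]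
      simp [div_eq_mul_inv]
    rw [← h1]
    refine norm_integral_le_of_norm_le ?_ ?_
    · exact (integrableOn_Ioi_rpow_of_lt (by linarith) one_pos).const_mul _
    · filter_upwards [ae_restrict_mem measurableSet_Ioi] with t ht
      have h0 : (0 : ℝ) < t := one_pos.trans ht
      rw [norm_mul, Complex.norm_cpow_eq_rpow_re_of_pos h0]
      have : (-(s + 1)).re = -s.re - 1 := by simp; ring
      rw [this]
      gcongr
      exact hB t (le_of_lt ht)
  · have h1 := LSeries_eq_mul_integral a zero_le_one hs (ha s hs) (by
      refine Asymptotics.IsBigO.of_bound (B + ‖κ‖) ?_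
      filter_upwards [eventually_ge_atTop 1] with n hn
      have hn' : (1 : ℝ) ≤ n := by exact_mod_cast hn
      have h2 := hB n hn'
      rw [Nat.floor_natCast] at h2
      have h3 : ‖κ * (n : ℝ)‖ = ‖κ‖ * n := by simp
      have h4 := norm_le_norm_sub_add (∑ k ∈ Finset.Icc 1 n, a k) (κ * (n : ℝ))
      rw [Real.rpow_one, Real.norm_natCast]
      nlinarith)
    have hs1 : s - 1 ≠ 0 := fun h => by
      rw [sub_eq_zero] at h; simp [h] at hs
    beta_reduce
    rw [h1, hI]
    have h2 : ∫ t in Ioi (1 : ℝ), κ * (t : ℂ) ^ (-s) = κ / (s - 1) := by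
      rw [integral_const_mul, integral_Ioi_cpow_of_lt (by simpa using hs) one_pos]
      have : -s + 1 ≠ 0 := by contrapose! hs1; linear_combination -hs1
      simp
      field_simp
      ring_nf
    have h3 : ∫ t in Ioi (1 : ℝ), (∑ k ∈ Finset.Icc 1 ⌊t⌋₊, a k) * (t : ℂ) ^ (-(s + 1)) =
        (∫ t in Ioi (1 : ℝ), E t * (t : ℂ) ^ (-(s + 1))) +
          ∫ t in Ioi (1 : ℝ), κ * (t : ℂ) ^ (-s) := by
      rw [← integral_add (hintegrable s (by linarith))]
      · refine setIntegral_congr_fun measurableSet_Ioi fun t ht => ?_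
        have h0 : (t : ℂ) ≠ 0 := by exact_mod_cast (one_pos.trans ht).ne'
        simp only [hE]
        rw [neg_add, Complex.cpow_add _ _ h0, Complex.cpow_neg_one]
        field_simp
        ring
      · exact (integrableOn_Ioi_cpow_of_lt (by simpa using hs) one_pos).const_mul _
    rw [h3, h2]
    ring

theorem DirichletCharacter.norm_sum_Icc_le {N : ℕ} [NeZero N] {χ : DirichletCharacter ℂ N}
    (hχ : χ ≠ 1) (n : ℕ) : ‖∑ k ∈ Finset.Icc 1 n, χ (k : ZMod N)‖ ≤ N := by
  have hper (m : ℕ) : ∑ k ∈ Finset.Ioc m (m + N), χ (k : ZMod N) = 0 := by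
    have h1 : ∑ a : ZMod N, χ a = 0 := MulChar.sum_eq_zero_of_ne_one hχ
    rw [← h1]
    have hinj : Set.InjOn (fun k : ℕ => (k : ZMod N)) (Finset.Ioc m (m + N)) := by
      intro a ha b hb hab
      rw [Finset.coe_Ioc, Set.mem_Ioc] at ha hb
      exact ((ZMod.natCast_eq_natCast_iff _ _ _).1 hab).eq_of_abs_lt (by rw [abs_lt]; omega)
    have himg : (Finset.Ioc m (m + N)).image (fun k : ℕ => (k : ZMod N)) = Finset.univ :=
      Finset.eq_univ_of_card _ (by rw [Finset.card_image_of_injOn hinj]; simp [ZMod.card])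
    rw [← himg, Finset.sum_image hinj]
  induction n using Nat.strong_induction_on with
  | _ n ih =>
    by_cases hn : n ≤ N
    · refine (norm_sum_le _ _).trans ?_
      refine (Finset.sum_le_card_nsmul _ _ 1 fun k _ => χ.norm_le_one _).trans ?_
      simpa using hn
    · have hN := NeZero.pos N
      have h := ih (n - N) (by omega)
      have h2 : Finset.Icc 1 n = Finset.Icc 1 (n - N) ∪ Finset.Ioc (n - N) (n - N + N) := by
        ext; simp; omega
      rw [h2, Finset.sum_union, hper, add_zero]
      · exact h
      · rw [Finset.disjoint_left]
        intro a; simp; omega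

theorem eq_of_eq_of_one_lt_re {f g : ℂ → ℂ} (hf : ∀ s, 0 < s.re → DifferentiableAt ℂ f s)
    (hg : ∀ s, 0 < s.re → DifferentiableAt ℂ g s) (h : ∀ s, 1 < s.re → f s = g s) {s : ℂ}
    (hs : 0 < s.re) : f s = g s := by
  have hU : IsOpen {s : ℂ | 0 < s.re} := isOpen_lt continuous_const Complex.continuous_re
  refine AnalyticOnNhd.eqOn_of_preconnected_of_eventuallyEq (z₀ := 2) (U := {s : ℂ | 0 < s.re})
    (DifferentiableOn.analyticOnNhd (fun z hz => (hf z hz).differentiableWithinAt) hU)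
    (DifferentiableOn.analyticOnNhd (fun z hz => (hg z hz).differentiableWithinAt) hU)
    (convex_halfSpace_re_gt 0).isPreconnected (by simp) ?_ hs
  filter_upwards [(isOpen_lt continuous_const Complex.continuous_re).mem_nhds
    (show (1 : ℝ) < (2 : ℂ).re by simp)] with z hz using h z hz

theorem DirichletCharacter.norm_LFunction_le {N : ℕ} [NeZero N] {χ : DirichletCharacter ℂ N}
    (hχ : χ ≠ 1) {s : ℂ} (hs : 0 < s.re) : ‖χ.LFunction s‖ ≤ ‖s‖ * N / s.re := by
  obtain ⟨I, h1, h2, h3⟩ := LSeries_exists_analytic_remainder (a := fun n => χ n) (κ := 0) (B := N)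
    (fun s hs => χ.LSeriesSummable_of_one_lt_re hs)
    (fun t _ => by simpa using norm_sum_Icc_le hχ ⌊t⌋₊)
  have h4 : χ.LFunction s = s * I s :=
    eq_of_eq_of_one_lt_re (g := fun s => s * I s) (fun z _ => differentiable_LFunction hχ z)
      (fun z hz => differentiableAt_id.mul (h1 z hz))
      (fun z hz => by rw [LFunction_eq_LSeries χ hz, h3 z hz]; simp) hs
  rw [h4, norm_mul, mul_div_assoc]
  gcongr
  exact h2 s hs

theorem DirichletCharacter.norm_LFunctionTrivChar₁_one_le {s : ℂ} (hs : 0 < s.re) :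
    ‖LFunctionTrivChar₁ 1 s‖ ≤ ‖s‖ + ‖s - 1‖ * ‖s‖ / s.re := by
  obtain ⟨I, h1, h2, h3⟩ := LSeries_exists_analytic_remainder (a := 1) (κ := 1) (B := 1)
    (fun s hs => LSeriesSummable_one_iff.2 hs)
    (fun t ht => by
      have : (∑ k ∈ Finset.Icc 1 ⌊t⌋₊, (1 : ℕ → ℂ) k) - 1 * t = ((⌊t⌋₊ - t : ℝ) : ℂ) := by
        simp
      rw [this, Complex.norm_real, Real.norm_eq_abs, abs_le]
      constructor
      · linarith [Nat.lt_floor_add_one t]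
      · linarith [Nat.floor_le (zero_le_one.trans ht)])
  have h4 : LFunctionTrivChar₁ 1 s = (s - 1) * (s * I s) + s :=
    eq_of_eq_of_one_lt_re (g := fun s => (s - 1) * (s * I s) + s)
      (fun z _ => differentiable_LFunctionTrivChar₁ 1 z)
      (fun z hz => ((differentiableAt_id.sub_const 1).mul
        (differentiableAt_id.mul (h1 z hz))).add differentiableAt_id)
      (fun z hz => by
        have hz1 : z ≠ 1 := by rintro rfl; simp at hz
        have hz2 : z - 1 ≠ 0 := sub_ne_zero.2 hz1
        have h5 := h3 z hz
        rw [LFunctionTrivChar₁, Function.update_of_ne hz1]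
        rw [LFunctionTrivChar, LFunction_modOne_eq, ← LSeries_one_eq_riemannZeta hz, h5]
        field_simp) hs
  rw [h4, add_comm, mul_div_assoc]
  refine (norm_add_le _ _).trans ?_
  rw [norm_mul, norm_mul, ← mul_one_div ‖s‖ s.re]
  gcongr
  exact h2 s hs

theorem DirichletCharacter.quarter_le_norm_LFunction {N : ℕ} [NeZero N]
    (χ : DirichletCharacter ℂ N) {s : ℂ} (hs : s.re = 2) : 1 / 4 ≤ ‖χ.LFunction s‖ := by
  have hs1 : 1 < s.re := by rw [hs]; norm_num
  rw [LFunction_eq_LSeries χ hs1]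
  have h1 : HasSum (fun n => LSeries.term (fun n => χ n) s n) (LSeries (fun n => χ n) s) :=
    (χ.LSeriesSummable_of_one_lt_re hs1).LSeriesHasSum
  have h2 : LSeries.term (fun n => χ n) s 1 = 1 := by simp
  have h3 : HasSum (fun n => LSeries.term (fun n => χ n) s (n + 2))
      (LSeries (fun n => χ n) s - 1) := by
    have := (hasSum_nat_add_iff' (f := fun n => LSeries.term (fun n => χ n) s n) 2).2 h1
    simpa [Finset.sum_range_succ] using this
  have h4 : HasSum (fun n : ℕ => 1 / ((n + 2 : ℕ) : ℝ) ^ 2) (Real.pi ^ 2 / 6 - 1) := by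
    have := (hasSum_nat_add_iff' (f := fun n : ℕ => 1 / (n : ℝ) ^ 2) 2).2 hasSum_zeta_two
    simpa [Finset.sum_range_succ] using this
  have h5 : ‖LSeries (fun n => χ n) s - 1‖ ≤ Real.pi ^ 2 / 6 - 1 := by
    refine (tsum_of_norm_bounded h4 fun n => ?_).trans_eq' (by rw [h3.tsum_eq])
    rw [LSeries.norm_term_eq, if_neg (by omega), hs]
    gcongr
    · exact χ.norm_le_one _
    · norm_num
  have h6 := norm_sub_norm_le (1 : ℂ) (1 - LSeries (fun n => χ n) s)
  rw [norm_sub_rev 1 (LSeries _ _)] at h6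
  have := Real.pi_lt_d2
  have := Real.pi_pos
  simp only [norm_one, sub_sub_cancel] at h6
  nlinarith

section LogDerivCoeff

open ArithmeticFunction

/-- The coefficient of `(s - z) ^ n` in the Taylor expansion of `logDeriv f z` at `s`. -/
noncomputable def logDerivCoeff (f : ℂ → ℂ) (n : ℕ) (s : ℂ) : ℂ :=
  (-1) ^ n / (n.factorial : ℂ) * iteratedDeriv n (logDeriv f) s

theorem logDerivCoeff_comp_const_add (f : ℂ → ℂ) (n : ℕ) (c s : ℂ) :
    logDerivCoeff (fun z => f (c + z)) n s = logDerivCoeff f n (c + s) := by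
  have h : logDeriv (fun z => f (c + z)) = fun z => logDeriv f (c + z) := by
    ext z
    simp [logDeriv_apply, deriv_comp_const_add]
  rw [logDerivCoeff, h, iteratedDeriv_comp_const_add, logDerivCoeff]

theorem logDerivCoeff_congr {f g : ℂ → ℂ} {s : ℂ} (h : f =ᶠ[nhds s] g) (n : ℕ) :
    logDerivCoeff f n s = logDerivCoeff g n s := by
  rw [logDerivCoeff, logDerivCoeff, Filter.EventuallyEq.iteratedDeriv_eq n]
  filter_upwards [h.eventuallyEq_nhds] with z hz
  rw [logDeriv_apply, logDeriv_apply, hz.deriv_eq, hz.eq_of_nhds]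

theorem AnalyticAt.logDeriv {f : ℂ → ℂ} {s : ℂ} (hf : AnalyticAt ℂ f s) (h0 : f s ≠ 0) :
    AnalyticAt ℂ (logDeriv f) s := hf.deriv.div hf h0

theorem logDerivCoeff_mul {f g : ℂ → ℂ} {s : ℂ} (hf : AnalyticAt ℂ f s) (hg : AnalyticAt ℂ g s)
    (hf0 : f s ≠ 0) (hg0 : g s ≠ 0) (n : ℕ) :
    logDerivCoeff (fun z => f z * g z) n s = logDerivCoeff f n s + logDerivCoeff g n s := by
  have h : logDeriv (fun z => f z * g z) =ᶠ[nhds s] logDeriv f + logDeriv g := by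
    filter_upwards [hf.eventually_analyticAt, hg.eventually_analyticAt,
      hf.continuousAt.eventually_ne hf0, hg.continuousAt.eventually_ne hg0] with z h1 h2 h3 h4
    exact logDeriv_mul z h3 h4 h1.differentiableAt h2.differentiableAt
  rw [logDerivCoeff, h.iteratedDeriv_eq, iteratedDeriv_add (hf.logDeriv hf0).contDiffAt
    (hg.logDeriv hg0).contDiffAt, mul_add, logDerivCoeff, logDerivCoeff]

theorem logDerivCoeff_sub_const (c s : ℂ) (n : ℕ) :
    logDerivCoeff (fun z => z - c) n s = (s - c)⁻¹ ^ (n + 1) := by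
  have h : logDeriv (fun z => z - c) = fun z => (-c + z)⁻¹ := by
    ext z
    simp [logDeriv_apply, sub_eq_neg_add]
  rw [logDerivCoeff, h, iteratedDeriv_comp_const_add n (fun z : ℂ => z⁻¹)]
  rw [iteratedDeriv_eq_iterate, iter_deriv_inv']
  have h1 : ((-1 : ℂ) ^ n) * (-1) ^ n = 1 := by rw [← mul_pow]; simp
  have h2 : (n.factorial : ℂ) ≠ 0 := by exact_mod_cast n.factorial_ne_zero
  beta_reduce
  rw [show (-1 - n : ℤ) = -((n + 1 : ℕ) : ℤ) by push_cast; ring, zpow_neg, zpow_natCast, inv_pow,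
    neg_add_eq_sub]
  have h3 : (n.factorial : ℂ) * (n.factorial : ℂ)⁻¹ = 1 := mul_inv_cancel₀ h2
  linear_combination ((s - c) ^ (n + 1))⁻¹ * ((n.factorial : ℂ) * (n.factorial : ℂ)⁻¹ * h1 + h3)

/-- The weight `Λ(k) (log k)^n / (n! k²)`. -/
noncomputable def vonMangoldtWeight (n k : ℕ) : ℝ :=
  Λ k * Real.log k ^ n / (n.factorial * k ^ 2)

theorem vonMangoldtWeight_nonneg (n k : ℕ) : 0 ≤ vonMangoldtWeight n k := by
  have := Real.log_natCast_nonneg k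
  have := vonMangoldt_nonneg (n := k)
  unfold vonMangoldtWeight
  positivity

theorem iterate_logMul_apply (f : ℕ → ℂ) (n k : ℕ) :
    (LSeries.logMul^[n] f) k = (Real.log k : ℂ) ^ n * f k := by
  induction n with
  | zero => simp
  | succ n ih =>
    rw [Function.iterate_succ_apply', LSeries.logMul, ih, Complex.natCast_log]
    ring

theorem DirichletCharacter.hasSum_logDerivCoeff_LFunction {N : ℕ} [NeZero N]
    (χ : DirichletCharacter ℂ N) (n : ℕ) (γ : ℝ) :
    HasSum (fun k : ℕ => (vonMangoldtWeight n k : ℂ) * (χ k * (k : ℂ) ^ (-(γ * Complex.I))))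
      (-logDerivCoeff χ.LFunction n (2 + γ * Complex.I)) := by
  set s : ℂ := 2 + γ * Complex.I with hs
  have hs1 : 1 < s.re := by simp [hs]
  set a : ℕ → ℂ := (fun n : ℕ => χ (n : ZMod N)) * fun n : ℕ => (Λ n : ℂ) with ha
  have hab : LSeries.abscissaOfAbsConv a ≤ 1 :=
    LSeries.abscissaOfAbsConv_le_of_forall_lt_LSeriesSummable' fun y hy => by
      exact χ.LSeriesSummable_twist_vonMangoldt (by exact_mod_cast hy)
  have hab' : LSeries.abscissaOfAbsConv a < s.re := hab.trans_lt (by exact_mod_cast hs1)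
  have h1 : logDeriv χ.LFunction =ᶠ[nhds s] -LSeries a := by
    filter_upwards [(isOpen_lt continuous_const Complex.continuous_re).mem_nhds hs1] with z hz
    rw [Pi.neg_apply, χ.LSeries_twist_vonMangoldt_eq hz, logDeriv_apply,
      deriv_LFunction_eq_deriv_LSeries χ hz, LFunction_eq_LSeries χ hz, neg_div, neg_neg]
  have h2 : iteratedDeriv n (logDeriv χ.LFunction) s =
      -((-1) ^ n * LSeries (LSeries.logMul^[n] a) s) := by
    rw [h1.iteratedDeriv_eq, iteratedDeriv_neg, LSeries_iteratedDeriv n hab']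
  have h3 : -logDerivCoeff χ.LFunction n s =
      ((n.factorial : ℂ))⁻¹ * LSeries (LSeries.logMul^[n] a) s := by
    rw [logDerivCoeff, h2]
    have : ((-1 : ℂ) ^ n) * (-1) ^ n = 1 := by rw [← mul_pow]; simp
    linear_combination ((n.factorial : ℂ))⁻¹ * LSeries (LSeries.logMul^[n] a) s * this
  rw [h3]
  have h4 : LSeriesSummable (LSeries.logMul^[n] a) s :=
    LSeriesSummable_of_abscissaOfAbsConv_lt_re (by rwa [LSeries.absicssaOfAbsConv_logPowMul])
  have h5 : HasSum (fun k => ((n.factorial : ℂ))⁻¹ * LSeries.term (LSeries.logMul^[n] a) s k)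
    (((n.factorial : ℂ))⁻¹ * LSeries (LSeries.logMul^[n] a) s) := h4.LSeriesHasSum.mul_left _
  convert h5 using 2 with k
  rcases Nat.eq_zero_or_pos k with rfl | hk
  · simp [vonMangoldtWeight]
  · have hk0 : (k : ℂ) ≠ 0 := by exact_mod_cast hk.ne'
    rw [LSeries.term_of_ne_zero hk.ne', iterate_logMul_apply, hs, Complex.cpow_add _ _ hk0,
      Complex.cpow_neg, Complex.cpow_ofNat, ha]
    simp only [vonMangoldtWeight, Pi.mul_apply]
    push_cast
    field_simp

theorem DirichletCharacter.re_logDerivCoeff_add_nonpos {q q' M : ℕ} [NeZero q] [NeZero q']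
    [NeZero M] {χ : DirichletCharacter ℂ q} (hχ : ∀ a, (χ a).im = 0) {χ' : DirichletCharacter ℂ q'}
    {ψ : DirichletCharacter ℂ M} (hψ : ∀ k : ℕ, ψ k = χ k * χ' k) (n : ℕ) (γ : ℝ) :
    (logDerivCoeff (LFunction (1 : DirichletCharacter ℂ 1)) n 2 + logDerivCoeff χ.LFunction n 2 +
      logDerivCoeff χ'.LFunction n (2 + γ * Complex.I) +
      logDerivCoeff ψ.LFunction n (2 + γ * Complex.I)).re ≤ 0 := by
  have h1 := (1 : DirichletCharacter ℂ 1).hasSum_logDerivCoeff_LFunction n 0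
  have h2 := χ.hasSum_logDerivCoeff_LFunction n 0
  have h3 := χ'.hasSum_logDerivCoeff_LFunction n γ
  have h4 := ψ.hasSum_logDerivCoeff_LFunction n γ
  have h5 := Complex.hasSum_re (((h1.add h2).add h3).add h4)
  have h6 := h5.nonneg fun k => ?_
  · simp only [Complex.ofReal_zero, zero_mul, add_zero] at h6
    simp only [Complex.add_re, Complex.neg_re] at h6 ⊢
    linarith
  · rcases Nat.eq_zero_or_pos k with rfl | hk
    · simp [vonMangoldtWeight]
    have hw := vonMangoldtWeight_nonneg n k
    set u : ℂ := χ' k * (k : ℂ) ^ (-(γ * Complex.I)) with hu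
    have hu1 : ‖u‖ ≤ 1 := by
      rw [hu, norm_mul, Complex.norm_natCast_cpow_of_pos hk]
      simpa using χ'.norm_le_one k
    have hχ1 : (χ k).re = χ k := Complex.ext (by simp) (by simp [hχ])
    have hχ2 := (Complex.abs_re_le_norm _).trans (χ.norm_le_one k)
    have hu2 := (Complex.abs_re_le_norm _).trans hu1
    have h7 : (vonMangoldtWeight n k : ℂ) * ((1 : DirichletCharacter ℂ 1) k *
          (k : ℂ) ^ (-(((0 : ℝ) : ℂ) * Complex.I))) +
        (vonMangoldtWeight n k : ℂ) * (χ k * (k : ℂ) ^ (-(((0 : ℝ) : ℂ) * Complex.I))) +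
        (vonMangoldtWeight n k : ℂ) * (χ' k * (k : ℂ) ^ (-(γ * Complex.I))) +
        (vonMangoldtWeight n k : ℂ) * (ψ k * (k : ℂ) ^ (-(γ * Complex.I))) =
        ((vonMangoldtWeight n k * (1 + (χ k).re) : ℝ) : ℂ) * (1 + u) := by
      rw [hψ, Complex.ofReal_mul, Complex.ofReal_add, hχ1, hu]
      have : (1 : DirichletCharacter ℂ 1) k = 1 := by
        rw [MulChar.one_apply (isUnit_of_subsingleton _)]
      simp [this]
      ring
    rw [h7, Complex.re_ofReal_mul]
    rw [abs_le] at hχ2 hu2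
    have : (1 + u).re = 1 + u.re := by simp
    rw [this]
    exact mul_nonneg (mul_nonneg hw (by linarith)) (by linarith)

end LogDerivCoeff

theorem norm_pow_sub_pow_le_of_norm_le_one {a b : ℂ} (ha : ‖a‖ ≤ 1) (hb : ‖b‖ ≤ 1) (n : ℕ) :
    ‖a ^ n - b ^ n‖ ≤ n * ‖a - b‖ := by
  induction n with
  | zero => simp
  | succ n ih =>
    have h : a ^ (n + 1) - b ^ (n + 1) = a ^ n * (a - b) + (a ^ n - b ^ n) * b := by ring
    rw [h]
    refine (norm_add_le _ _).trans ?_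
    rw [norm_mul, norm_mul, norm_pow]
    have h1 : ‖a‖ ^ n ≤ 1 := pow_le_one₀ (norm_nonneg _) ha
    push_cast
    nlinarith [norm_nonneg (a - b), norm_nonneg (a ^ n - b ^ n), norm_nonneg b]

theorem exists_multiset_re_power_sum_le {f g : ℂ → ℂ} (hf : Differentiable ℂ f)
    (hg : Differentiable ℂ g) (hf0 : f 0 ≠ 0) (hg0 : g 0 ≠ 0) {m : ℝ} (hm : 0 < m)
    (hfm : ∀ s, ‖s‖ ≤ 9 / 5 → ‖f s‖ ≤ Real.exp m * ‖f 0‖)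
    (hgm : ∀ s, ‖s‖ ≤ 9 / 5 → ‖g s‖ ≤ Real.exp m * ‖g 0‖) {δ : ℝ} (hδ : 0 < δ) (hδ' : δ ≤ 1 / 10)
    {z : ℂ} (hz : ‖z‖ ≤ 17 / 10) (hgz : g z = 0) (hfδ : f (-(1 + δ)) = 0)
    (h : (∀ n, (logDerivCoeff f n 0 + logDerivCoeff g n 0).re ≤ 1) ∨
      ∃ v : ℂ, v.re = 1 ∧ g (-(v + δ)) = 0 ∧ z ≠ -(v + δ) ∧
        ∀ n, (logDerivCoeff f n 0 + logDerivCoeff g n 0).re ≤ 1 + (v⁻¹ ^ (n + 1)).re) :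
    ∃ W : Multiset ℂ, (W.card : ℝ) ≤ 36 * m ∧ -z⁻¹ ∈ W ∧
      ∀ n : ℕ, ((W.map (· ^ (n + 1))).sum).re ≤
        2 * (n + 1) * δ + (2800 * m + 1) * (5 / 8) ^ n := by
  obtain ⟨Wf, hf1, hf2, hf3⟩ := exists_approx_iteratedDeriv_logDeriv hf hf0 hm hfm
  obtain ⟨Wg, hg1, hg2, hg3⟩ := exists_approx_iteratedDeriv_logDeriv hg hg0 hm hgm
  change ∀ n, ‖logDerivCoeff f n 0 - _‖ ≤ _ at hf3
  change ∀ n, ‖logDerivCoeff g n 0 - _‖ ≤ _ at hg3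
  have hδ1 : ‖(1 + δ : ℂ)‖ = 1 + δ := by
    rw [← Complex.ofReal_one, ← Complex.ofReal_add, Complex.norm_of_nonneg (by linarith)]
  have hmem : (1 + δ : ℂ)⁻¹ ∈ Wf := by
    have := hf2 (-(1 + δ)) (by rw [norm_neg, hδ1]; linarith) hfδ
    rwa [inv_neg, neg_neg] at this
  obtain ⟨Wf', rfl⟩ := Multiset.exists_cons_of_mem hmem
  have hz' := hg2 z hz hgz
  have key (v : ℂ) (hv : v.re = 1) (n : ℕ) :
      (v⁻¹ ^ (n + 1)).re - ((v + δ)⁻¹ ^ (n + 1)).re ≤ (n + 1) * δ := by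
    have h1 : 1 ≤ ‖v‖ := by
      have := Complex.re_le_norm v; rwa [hv] at this
    have h2 : 1 ≤ ‖v + δ‖ := by
      have := Complex.re_le_norm (v + δ)
      rw [Complex.add_re, hv, Complex.ofReal_re] at this
      linarith
    have h3 := norm_pow_sub_pow_le_of_norm_le_one (a := v⁻¹) (b := (v + δ)⁻¹)
      (by rw [norm_inv]; exact inv_le_one_of_one_le₀ h1)
      (by rw [norm_inv]; exact inv_le_one_of_one_le₀ h2) (n + 1)
    have h4 : ‖v⁻¹ - (v + δ)⁻¹‖ ≤ δ := by
      have hv0 : v ≠ 0 := norm_pos_iff.1 (by linarith)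
      have hv1 : v + δ ≠ 0 := norm_pos_iff.1 (by linarith)
      rw [inv_sub_inv hv0 hv1, norm_div, norm_mul, add_sub_cancel_left,
        Complex.norm_of_nonneg hδ.le]
      exact div_le_self hδ.le (by nlinarith)
    rw [← Complex.sub_re]
    refine (Complex.re_le_norm _).trans (h3.trans ?_)
    push_cast
    gcongr
  have hre (n : ℕ) : ((Wf'.map (· ^ (n + 1))).sum).re + ((Wg.map (· ^ (n + 1))).sum).re ≤
      (logDerivCoeff f n 0 + logDerivCoeff g n 0).re - ((1 + δ : ℂ)⁻¹ ^ (n + 1)).re +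
        2800 * m * (5 / 8) ^ n := by
    have h1 := (Complex.abs_re_le_norm _).trans (hf3 n)
    have h2 := (Complex.abs_re_le_norm _).trans (hg3 n)
    rw [Multiset.map_cons, Multiset.sum_cons] at h1
    rw [abs_le] at h1 h2
    simp only [Complex.sub_re, Complex.add_re] at h1 h2 ⊢
    linarith [h1.1, h2.1]
  have hk1 (n : ℕ) := key 1 Complex.one_re n
  simp only [inv_one, one_pow, Complex.one_re] at hk1
  have hcard : ((Wf' + Wg).card : ℝ) ≤ 36 * m := by
    rw [Multiset.card_cons] at hf1
    push_cast [Multiset.card_add] at hf1 ⊢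
    linarith
  have hpow (n : ℕ) : (0 : ℝ) < (5 / 8) ^ n := by positivity
  rcases h with h | ⟨v, hv, hgv, hzv, h⟩
  · refine ⟨Wf' + Wg, hcard, Multiset.mem_add.2 (Or.inr hz'), fun n => ?_⟩
    rw [Multiset.map_add, Multiset.sum_add, Complex.add_re]
    have := mul_nonneg (by positivity : (0 : ℝ) ≤ n + 1) hδ.le
    linarith [hre n, h n, hk1 n, hpow n]
  · by_cases hvn : ‖v + δ‖ ≤ 17 / 10
    · have h1 := hg2 (-(v + δ)) (by rwa [norm_neg]) hgv
      rw [inv_neg, neg_neg] at h1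
      obtain ⟨Wg', rfl⟩ := Multiset.exists_cons_of_mem h1
      refine ⟨Wf' + Wg', ?_, Multiset.mem_add.2 (Or.inr ?_), fun n => ?_⟩
      · refine le_trans ?_ hcard
        gcongr
        exact Multiset.le_cons_self _ _
      · rcases Multiset.mem_cons.1 hz' with h2 | h2
        · exact absurd (by rw [← inv_inv (v + δ), ← h2, inv_neg, inv_inv, neg_neg]) hzv
        · exact h2
      · rw [Multiset.map_add, Multiset.sum_add, Complex.add_re]
        have h3 := hre n
        rw [Multiset.map_cons, Multiset.sum_cons, Complex.add_re] at h3
        linarith [h n, hk1 n, hpow n, key v hv n]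
    · refine ⟨Wf' + Wg, hcard, Multiset.mem_add.2 (Or.inr hz'), fun n => ?_⟩
      rw [Multiset.map_add, Multiset.sum_add, Complex.add_re]
      have h0 := mul_nonneg (by positivity : (0 : ℝ) ≤ n + 1) hδ.le
      have h2 : (v⁻¹ ^ (n + 1)).re ≤ (5 / 8) ^ n := by
        refine (Complex.re_le_norm _).trans ?_
        rw [norm_pow, norm_inv]
        have h3 : 8 / 5 ≤ ‖v‖ := by
          have := norm_add_le v δ
          rw [Complex.norm_of_nonneg hδ.le] at this
          linarith
        have h4 : ‖v‖⁻¹ ≤ 5 / 8 := by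
          rw [show (5 / 8 : ℝ) = (8 / 5)⁻¹ by norm_num]
          gcongr
        refine (pow_le_pow_left₀ (by positivity) h4 _).trans ?_
        exact pow_le_pow_of_le_one (by norm_num) (by norm_num) (Nat.le_succ n)
      linarith [hre n, h n, hk1 n]

theorem one_le_mul_exp_of_re_power_sum_le {W : Multiset ℂ} {δ E b : ℝ} (hδ : 0 ≤ δ) (hE : 0 ≤ E)
    (hb : b < 1) (hb' : 1 / 2 ≤ b) (hW : ((2 - b)⁻¹ : ℂ) ∈ W)
    (h : ∀ n : ℕ, ((W.map (· ^ (n + 1))).sum).re ≤ 2 * (n + 1) * δ + E * (5 / 8) ^ n)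
    {J : ℕ} (hJ : 0 < J) (hJE : 8 * (W.card + 48 * E) ≤ J) :
    1 ≤ 32 * J * δ * Real.exp (J * (1 - b)) := by
  obtain ⟨u, hu, hmax⟩ : ∃ u ∈ W, ∀ w ∈ W, ‖w‖ ≤ ‖u‖ := by
    obtain ⟨u, hu, hmax⟩ := W.toFinset.exists_max_image (fun w => ‖w‖) ⟨_, Multiset.mem_toFinset.2 hW⟩
    exact ⟨u, Multiset.mem_toFinset.1 hu, fun w hw => hmax w (Multiset.mem_toFinset.2 hw)⟩
  set R : ℝ := ‖u‖⁻¹ with hR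
  have h2b : ‖((2 - b)⁻¹ : ℂ)‖ = (2 - b)⁻¹ := by
    rw [norm_inv, ← Complex.ofReal_ofNat, ← Complex.ofReal_sub,
      Complex.norm_of_nonneg (by linarith)]
  have hu0 : (2 - b)⁻¹ ≤ ‖u‖ := h2b ▸ hmax _ hW
  have hu1 : 0 < ‖u‖ := lt_of_lt_of_le (inv_pos.2 (by linarith)) hu0
  have hR0 : 0 < R := inv_pos.2 hu1
  have hR1 : R ≤ 2 - b := inv_le_of_inv_le₀ (by linarith) hu0
  obtain ⟨a, ha, hlow⟩ := exists_weights_power_sum_lower_bound (W.map fun w => (R : ℂ) * w)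
    (by
      intro w hw
      obtain ⟨x, hx, rfl⟩ := Multiset.mem_map.1 hw
      rw [norm_mul, Complex.norm_of_nonneg hR0.le, hR, inv_mul_le_one₀ hu1]
      exact hmax x hx)
    (Multiset.mem_map_of_mem _ hu)
    (by rw [norm_mul, Complex.norm_of_nonneg hR0.le, hR, inv_mul_cancel₀ hu1.ne']) J
  have hterm (i : ℕ) (hi : i ∈ Finset.range J) :
      a i * ((((W.map fun w => (R : ℂ) * w)).map fun w => w ^ (i + 1)).sum).re ≤
        4 * J * δ * (2 - b) ^ J + 3 * E * (15 / 16) ^ i := by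
    have h1 : ((((W.map fun w => (R : ℂ) * w)).map fun w => w ^ (i + 1)).sum).re =
        R ^ (i + 1) * ((W.map (· ^ (i + 1))).sum).re := by
      rw [Multiset.map_map]
      simp only [Function.comp_def, mul_pow, Multiset.sum_map_mul_left]
      rw [← Complex.ofReal_pow, Complex.re_ofReal_mul]
    have hi' : i + 1 ≤ J := Finset.mem_range.1 hi
    have hi'' : (i : ℝ) + 1 ≤ J := by exact_mod_cast hi'
    obtain ⟨ha0, ha2⟩ := ha i hi
    have h3 : 0 ≤ 2 * (i + 1) * δ + E * (5 / 8) ^ i := by positivity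
    rw [h1]
    calc a i * (R ^ (i + 1) * ((W.map (· ^ (i + 1))).sum).re)
        ≤ a i * (R ^ (i + 1) * (2 * (i + 1) * δ + E * (5 / 8) ^ i)) := by
          gcongr; exact h i
      _ ≤ 2 * (R ^ (i + 1) * (2 * (i + 1) * δ + E * (5 / 8) ^ i)) := by gcongr
      _ = 4 * (i + 1) * δ * R ^ (i + 1) + 2 * E * (R ^ (i + 1) * (5 / 8) ^ i) := by ring
      _ ≤ _ := by
          have h4 : R ^ (i + 1) ≤ (2 - b) ^ J :=
            (pow_le_pow_left₀ hR0.le hR1 _).trans (pow_le_pow_right₀ (by linarith) hi')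
          have h5 : R ^ (i + 1) * (5 / 8) ^ i ≤ 3 / 2 * (15 / 16) ^ i := by
            calc R ^ (i + 1) * (5 / 8) ^ i ≤ (3 / 2) ^ (i + 1) * (5 / 8) ^ i := by
                  gcongr; linarith
              _ = 3 / 2 * (15 / 16) ^ i := by
                  rw [pow_succ, show (15 / 16 : ℝ) = 3 / 2 * (5 / 8) by norm_num, mul_pow]; ring
          have h6 : 4 * (i + 1) * δ * R ^ (i + 1) ≤ 4 * J * δ * (2 - b) ^ J := by gcongr
          nlinarith
  have hsum := hlow.trans (Finset.sum_le_sum hterm)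
  rw [Finset.sum_add_distrib, Finset.sum_const, Finset.card_range, nsmul_eq_mul,
    Multiset.card_map, ← Finset.mul_sum] at hsum
  have hgeom : ∑ i ∈ Finset.range J, (15 / 16 : ℝ) ^ i ≤ 16 := by
    rw [geom_sum_eq (by norm_num), div_le_iff_of_neg (by norm_num)]
    have : (0 : ℝ) < (15 / 16) ^ J := by positivity
    linarith
  have hexp : (2 - b) ^ J ≤ Real.exp (J * (1 - b)) := by
    rw [Real.exp_nat_mul]
    gcongr
    · linarith
    · linarith [Real.add_one_le_exp (1 - b)]
  have hJ' : (0 : ℝ) < J := by exact_mod_cast hJ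
  have h7 : (J : ℝ) * (4 * J * δ * (2 - b) ^ J) ≤ J * (4 * J * δ * Real.exp (J * (1 - b))) := by
    gcongr
  have h8 : (J : ℝ) / 8 ≤ J * (4 * J * δ * Real.exp (J * (1 - b))) := by
    have h10 := mul_le_mul_of_nonneg_left hgeom (by positivity : 0 ≤ 3 * E)
    linarith
  have h9 : (J : ℝ) * 1 ≤ J * (32 * J * δ * Real.exp (J * (1 - b))) := by linarith
  exact le_of_mul_le_mul_left h9 hJ'

namespace DirichletCharacter

theorem changeLevel_natCast {N M : ℕ} (χ : DirichletCharacter ℂ N) (h : N ∣ M) {k : ℕ}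
    (hk : k.Coprime M) : changeLevel h χ (k : ZMod M) = χ (k : ZMod N) := by
  have := changeLevel_eq_cast_of_dvd χ h (ZMod.unitOfCoprime k hk)
  rwa [ZMod.coe_unitOfCoprime, ZMod.cast_natCast h] at this

theorem changeLevel_mul_changeLevel_natCast {q q' : ℕ} (χ : DirichletCharacter ℂ q)
    (χ' : DirichletCharacter ℂ q') (k : ℕ) :
    (changeLevel (Nat.dvd_mul_right q q') χ * changeLevel (Nat.dvd_mul_left q' q) χ')
      (k : ZMod (q * q')) = χ k * χ' k := by
  rw [MulChar.mul_apply]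
  by_cases hk : k.Coprime (q * q')
  · rw [changeLevel_natCast _ _ hk, changeLevel_natCast _ _ hk]
  · rw [MulChar.map_nonunit _ (by rwa [ZMod.isUnit_iff_coprime]), zero_mul]
    rw [Nat.coprime_mul_iff_right, not_and_or] at hk
    rcases hk with hk | hk
    · rw [MulChar.map_nonunit χ (by rwa [ZMod.isUnit_iff_coprime]), zero_mul]
    · rw [MulChar.map_nonunit χ' (by rwa [ZMod.isUnit_iff_coprime]), mul_zero]

theorem inv_eq_self_of_im_eq_zero {q : ℕ} {χ : DirichletCharacter ℂ q}
    (hχ : ∀ a, (χ a).im = 0) : χ⁻¹ = χ := by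
  rw [← MulChar.star_eq_inv]
  ext a
  exact Complex.conj_eq_iff_im.2 (hχ a)

theorem one_sub_mul_cpow_ne_zero {q : ℕ} (χ : DirichletCharacter ℂ q) {s : ℂ} (hs : 0 < s.re)
    {p : ℕ} (hp : p.Prime) : 1 - χ p * (p : ℂ) ^ (-s) ≠ 0 := by
  intro h
  rw [sub_eq_zero] at h
  have h1 : ‖χ p * (p : ℂ) ^ (-s)‖ < 1 := by
    rw [norm_mul, Complex.norm_natCast_cpow_of_pos hp.pos]
    have h2 : (p : ℝ) ^ (-s).re < 1 :=
      Real.rpow_lt_one_of_one_lt_of_neg (by exact_mod_cast hp.one_lt) (by simpa)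
    exact (mul_le_of_le_one_left (by positivity) (χ.norm_le_one _)).trans_lt h2
  rw [← h] at h1
  simp at h1

theorem LFunction_changeLevel_eq_zero_iff {N M : ℕ} [NeZero N] [NeZero M] (h : N ∣ M)
    (χ : DirichletCharacter ℂ N) {s : ℂ} (hs : 0 < s.re) (hs1 : s ≠ 1) :
    LFunction (changeLevel h χ) s = 0 ↔ LFunction χ s = 0 := by
  rw [LFunction_changeLevel h χ (Or.inr hs1), mul_eq_zero, or_iff_left]
  rw [Finset.prod_eq_zero_iff]
  rintro ⟨p, hp, h0⟩
  exact one_sub_mul_cpow_ne_zero χ hs (Nat.prime_of_mem_primeFactors hp) h0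

theorem LFunctionTrivChar₁_one_eq_zero {N : ℕ} [NeZero N] {s : ℂ} (hs : 0 < s.re) (hs1 : s ≠ 1)
    (h : LFunction (1 : DirichletCharacter ℂ N) s = 0) : LFunctionTrivChar₁ 1 s = 0 := by
  rw [← changeLevel_one (one_dvd N), LFunction_changeLevel_eq_zero_iff _ _ hs hs1] at h
  rw [LFunctionTrivChar₁, Function.update_of_ne hs1, LFunctionTrivChar, h, mul_zero]

theorem LFunctionTrivChar₁_mul_LFunction_eq_zero {q q' : ℕ} [NeZero q] [NeZero q']
    {χ : DirichletCharacter ℂ q} (hχ : ∀ a, (χ a).im = 0) {χ' : DirichletCharacter ℂ q'} {s : ℂ}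
    (hs : 0 < s.re) (hs1 : s ≠ 1) (h : χ'.LFunction s = 0)
    (h1 : χ' = 1 ∨
      changeLevel (Nat.dvd_mul_right q q') χ * changeLevel (Nat.dvd_mul_left q' q) χ' = 1) :
    LFunctionTrivChar₁ 1 s * χ.LFunction s = 0 := by
  have : NeZero (q * q') := ⟨mul_ne_zero (NeZero.ne q) (NeZero.ne q')⟩
  rcases h1 with rfl | h1
  · rw [LFunctionTrivChar₁_one_eq_zero hs hs1 h, zero_mul]
  · rw [← LFunction_changeLevel_eq_zero_iff (Nat.dvd_mul_left q' q) _ hs hs1,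
      eq_inv_of_mul_eq_one_right h1, ← map_inv, inv_eq_self_of_im_eq_zero hχ,
      LFunction_changeLevel_eq_zero_iff _ _ hs hs1] at h
    rw [h, mul_zero]

theorem LFunction_ne_zero_of_one_lt_re {N : ℕ} [NeZero N] (χ : DirichletCharacter ℂ N) {s : ℂ}
    (hs : 1 < s.re) : χ.LFunction s ≠ 0 := by
  rw [LFunction_eq_LSeries χ hs]
  exact χ.LSeries_ne_zero_of_one_lt_re hs

theorem LFunctionTrivChar₁_one_eventuallyEq {s : ℂ} (hs : s ≠ 1) :
    LFunctionTrivChar₁ 1 =ᶠ[nhds s] fun z => (z - 1) * LFunction (1 : DirichletCharacter ℂ 1) z := by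
  filter_upwards [isOpen_ne.mem_nhds hs] with z hz
  rw [LFunctionTrivChar₁, Function.update_of_ne hz, LFunctionTrivChar]

theorem quarter_le_norm_LFunctionTrivChar₁_one {s : ℂ} (hs : s.re = 2) :
    1 / 4 ≤ ‖LFunctionTrivChar₁ 1 s‖ := by
  have hs1 : s ≠ 1 := by rintro rfl; norm_num at hs
  rw [(LFunctionTrivChar₁_one_eventuallyEq hs1).eq_of_nhds, norm_mul]
  have h1 := quarter_le_norm_LFunction (1 : DirichletCharacter ℂ 1) hs
  have h2 := Complex.re_le_norm (s - 1)
  simp only [Complex.sub_re, hs, Complex.one_re] at h2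
  nlinarith

theorem logDerivCoeff_LFunctionTrivChar₁_mul {N : ℕ} [NeZero N] {χ : DirichletCharacter ℂ N}
    (hχ : χ ≠ 1) {s : ℂ} (hs : 1 < s.re) (n : ℕ) :
    logDerivCoeff (fun z => LFunctionTrivChar₁ 1 z * χ.LFunction z) n s =
      (s - 1)⁻¹ ^ (n + 1) + logDerivCoeff (LFunction (1 : DirichletCharacter ℂ 1)) n s +
        logDerivCoeff χ.LFunction n s := by
  have hs1 : s ≠ 1 := by rintro rfl; simp at hs
  have h1 : AnalyticAt ℂ (LFunction (1 : DirichletCharacter ℂ 1)) s := by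
    refine DifferentiableOn.analyticAt (s := {1}ᶜ) (fun z hz => ?_) (isOpen_ne.mem_nhds hs1)
    exact (differentiableAt_LFunction _ z (Or.inl hz)).differentiableWithinAt
  have h0 := LFunction_ne_zero_of_one_lt_re (1 : DirichletCharacter ℂ 1) hs
  have he := LFunctionTrivChar₁_one_eventuallyEq hs1
  rw [logDerivCoeff_mul ((differentiable_LFunctionTrivChar₁ 1).analyticAt s)
    ((differentiable_LFunction hχ).analyticAt s) ?_ (LFunction_ne_zero_of_one_lt_re χ hs),
    logDerivCoeff_congr he, logDerivCoeff_mul (f := fun z => z - 1) (by fun_prop) h1 (sub_ne_zero.2 hs1) h0,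
    logDerivCoeff_sub_const]
  rw [he.eq_of_nhds]
  exact mul_ne_zero (sub_ne_zero.2 hs1) h0

theorem norm_LFunction_le_of_re {N : ℕ} [NeZero N] {χ : DirichletCharacter ℂ N} (hχ : χ ≠ 1)
    {s : ℂ} {R : ℝ} (hs : 1 / 5 ≤ s.re) (hR : ‖s‖ ≤ R) : ‖χ.LFunction s‖ ≤ 5 * N * R := by
  refine (norm_LFunction_le hχ (by linarith)).trans ?_
  rw [div_le_iff₀ (by linarith)]
  have hN : (0 : ℝ) ≤ N := by positivity
  have h0 := (norm_nonneg s).trans hR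
  calc ‖s‖ * N ≤ R * N := by gcongr
    _ = 5 * N * R * (1 / 5) := by ring
    _ ≤ 5 * N * R * s.re := by gcongr

theorem norm_LFunctionTrivChar₁_one_le_of_re {s : ℂ} {R : ℝ} (hR1 : 1 ≤ R) (hs : 1 / 5 ≤ s.re)
    (hR : ‖s‖ ≤ R) : ‖LFunctionTrivChar₁ 1 s‖ ≤ 11 * R ^ 2 := by
  refine (norm_LFunctionTrivChar₁_one_le (by linarith)).trans ?_
  have h1 : ‖s - 1‖ ≤ R + 1 := (norm_sub_le _ _).trans (by simpa using hR)
  have h2 : ‖s - 1‖ * ‖s‖ / s.re ≤ 5 * ((R + 1) * R) := by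
    rw [div_le_iff₀ (by linarith)]
    calc ‖s - 1‖ * ‖s‖ ≤ (R + 1) * R := by gcongr
      _ = 5 * ((R + 1) * R) * (1 / 5) := by ring
      _ ≤ _ := by gcongr
  nlinarith

theorem exists_multiset_of_LFunction_zeros {q q' : ℕ} [NeZero q] [NeZero q']
    {χ : DirichletCharacter ℂ q} {χ' : DirichletCharacter ℂ q'} {T δ : ℝ} (hT : 1600 ≤ T)
    (hq : (q : ℝ) ≤ T) (hq' : (q' : ℝ) ≤ T) (hχ : ∀ a, (χ a).im = 0) (hχ1 : χ ≠ 1) (hδ : 0 < δ)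
    (hδ' : δ ≤ 1 / 10) (hzero : χ.LFunction (1 - δ) = 0) {ρ : ℂ} (hρ : 1 / 2 ≤ ρ.re)
    (hρ' : ρ.re < 1) (hρT : |ρ.im| ≤ T) (hρ0 : χ'.LFunction ρ = 0) (hne : ρ ≠ 1 - δ) :
    ∃ W : Multiset ℂ, (W.card : ℝ) ≤ 36 * (6 * Real.log T) ∧ ((2 - ρ.re)⁻¹ : ℂ) ∈ W ∧
      ∀ n : ℕ, ((W.map (· ^ (n + 1))).sum).re ≤
        2 * (n + 1) * δ + (2800 * (6 * Real.log T) + 1) * (5 / 8) ^ n := by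
  have hlog : 0 < Real.log T := Real.log_pos (by linarith)
  have hexp : Real.exp (6 * Real.log T) = T ^ 6 := by
    rw [← Real.rpow_natCast, Real.rpow_def_of_pos (by linarith)]
    norm_num [mul_comm]
  have hbound {F : ℂ → ℂ} {s : ℂ} (h0 : 1 / 16 ≤ ‖F 0‖) (h1 : ‖F s‖ ≤ 100 * T ^ 5) :
      ‖F s‖ ≤ Real.exp (6 * Real.log T) * ‖F 0‖ := by
    rw [hexp]
    have : 0 ≤ T ^ 5 := by positivity
    nlinarith [mul_nonneg this (by linarith : 0 ≤ T - 1600),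
      mul_nonneg (mul_nonneg this (by linarith : 0 ≤ T)) (by linarith : 0 ≤ ‖F 0‖ - 1 / 16)]
  have hshift {s : ℂ} {y : ℝ} (hs : ‖s‖ ≤ 9 / 5) (hy : |y| ≤ T) :
      1 / 5 ≤ (2 + y * Complex.I + s).re ∧ ‖2 + y * Complex.I + s‖ ≤ 2 * T := by
    constructor
    · have := (abs_le.1 ((Complex.abs_re_le_norm s).trans hs)).1
      simp
      linarith
    · refine (norm_add₃_le).trans ?_
      simp
      linarith
  set A : ℂ → ℂ := fun z => LFunctionTrivChar₁ 1 z * χ.LFunction z with hA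
  have hAd : Differentiable ℂ A :=
    (differentiable_LFunctionTrivChar₁ 1).mul (differentiable_LFunction hχ1)
  have hA0 {s : ℂ} (hs : s.re = 2) : 1 / 16 ≤ ‖A s‖ := by
    rw [hA, norm_mul]
    nlinarith [quarter_le_norm_LFunctionTrivChar₁_one hs, quarter_le_norm_LFunction χ hs]
  have hAb {s : ℂ} {y : ℝ} (hs : ‖s‖ ≤ 9 / 5) (hy : |y| ≤ T) :
      ‖A (2 + y * Complex.I + s)‖ ≤ 100 * T ^ 5 := by
    obtain ⟨h1, h2⟩ := hshift hs hy
    rw [hA, norm_mul]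
    calc _ ≤ (11 * (2 * T) ^ 2) * (5 * q * (2 * T)) :=
          mul_le_mul (norm_LFunctionTrivChar₁_one_le_of_re (by linarith) h1 h2)
            (norm_LFunction_le_of_re hχ1 h1 h2) (norm_nonneg _) (by positivity)
      _ ≤ (11 * (2 * T) ^ 2) * (5 * T * (2 * T)) := by gcongr
      _ = 440 * T ^ 4 := by ring
      _ ≤ 100 * T ^ 5 := by
          have : 0 ≤ T ^ 4 := by positivity
          nlinarith
  have hAδ : A (1 - δ) = 0 := by rw [hA]; simp [hzero]
  have hT0 : |(0 : ℝ)| ≤ T := by simp; linarith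
  set f : ℂ → ℂ := fun s => A (2 + s) with hf
  have hfd : Differentiable ℂ f := hAd.comp (differentiable_id.const_add 2)
  have hf0 : 1 / 16 ≤ ‖f 0‖ := hA0 (by simp)
  have hfb (s : ℂ) (hs : ‖s‖ ≤ 9 / 5) : ‖f s‖ ≤ Real.exp (6 * Real.log T) * ‖f 0‖ :=
    hbound hf0 (by simpa [hf] using hAb hs hT0)
  have hfδ : f (-(1 + δ)) = 0 := by
    rw [hf, ← hAδ]; beta_reduce; congr 1; ring
  have hfc (n : ℕ) : logDerivCoeff f n 0 =
      1 + logDerivCoeff (LFunction (1 : DirichletCharacter ℂ 1)) n 2 +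
        logDerivCoeff χ.LFunction n 2 := by
    rw [hf, logDerivCoeff_comp_const_add, add_zero, hA,
      logDerivCoeff_LFunctionTrivChar₁_mul hχ1 (by simp)]
    norm_num
  set c : ℂ := 2 + ρ.im * Complex.I with hc
  have hcre : c.re = 2 := by simp [hc]
  have hnz {a : ℂ} (h : 1 / 16 ≤ ‖a‖) : a ≠ 0 := norm_pos_iff.1 (by linarith)
  have hzρ : c + (ρ.re - 2 : ℝ) = ρ := by
    apply Complex.ext <;> simp [hc]
  have hznorm : ‖((ρ.re - 2 : ℝ) : ℂ)‖ ≤ 17 / 10 := by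
    rw [Complex.norm_real, Real.norm_eq_abs, abs_le]
    constructor <;> linarith
  have hzinv : -((ρ.re - 2 : ℝ) : ℂ)⁻¹ = ((2 : ℂ) - (ρ.re : ℂ))⁻¹ := by
    rw [← inv_neg]; push_cast; ring
  rw [← hzinv]
  by_cases hcase : χ' = 1 ∨
      changeLevel (Nat.dvd_mul_right q q') χ * changeLevel (Nat.dvd_mul_left q' q) χ' = 1
  · have hρA : A ρ = 0 := LFunctionTrivChar₁_mul_LFunction_eq_zero hχ (by linarith)
      (by rintro rfl; simp at hρ') hρ0 hcase
    have hg0 : 1 / 16 ≤ ‖(fun s => A (c + s)) 0‖ := hA0 (by simp [hcre])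
    refine exists_multiset_re_power_sum_le (g := fun s => A (c + s)) hfd
      (hAd.comp (differentiable_id.const_add c)) (hnz hf0) (hnz hg0) (by positivity) hfb
      (fun s hs => hbound (F := fun s => A (c + s)) hg0 (hAb hs hρT)) hδ hδ' hznorm
      (by rw [hzρ, hρA]) hfδ (Or.inr ⟨1 + ρ.im * Complex.I, by simp, ?_, ?_, fun n => ?_⟩)
    · rw [← hAδ, hc]; congr 1; ring
    · intro h
      refine hne ?_
      rw [← hzρ, h, hc]; ring
    · have h1 := re_logDerivCoeff_add_nonpos hχ (χ' := (1 : DirichletCharacter ℂ 1)) (ψ := χ)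
        (fun k => by rw [MulChar.one_apply (isUnit_of_subsingleton _), mul_one]) n ρ.im
      have hc1 : c - 1 = 1 + ρ.im * Complex.I := by rw [hc]; ring
      rw [hfc, logDerivCoeff_comp_const_add A, add_zero, hA,
        logDerivCoeff_LFunctionTrivChar₁_mul hχ1 (by simp [hcre]), hc1]
      simp only [Complex.add_re, Complex.one_re] at h1 ⊢
      linarith
  · push Not at hcase
    have : NeZero (q * q') := ⟨mul_ne_zero (NeZero.ne q) (NeZero.ne q')⟩
    set ψ := changeLevel (Nat.dvd_mul_right q q') χ * changeLevel (Nat.dvd_mul_left q' q) χ'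
      with hψ
    have hg0 : 1 / 16 ≤ ‖(fun s => χ'.LFunction (c + s) * ψ.LFunction (c + s)) 0‖ := by
      beta_reduce
      rw [norm_mul, add_zero]
      nlinarith [quarter_le_norm_LFunction χ' hcre, quarter_le_norm_LFunction ψ hcre]
    refine exists_multiset_re_power_sum_le
      (g := fun s => χ'.LFunction (c + s) * ψ.LFunction (c + s)) hfd
      (((differentiable_LFunction hcase.1).comp (differentiable_id.const_add c)).mul
        ((differentiable_LFunction hcase.2).comp (differentiable_id.const_add c)))
      (hnz hf0) (hnz hg0) (by positivity) hfb
      (fun s hs => hbound (F := fun s => χ'.LFunction (c + s) * ψ.LFunction (c + s)) hg0 ?_)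
      hδ hδ' hznorm (by rw [hzρ, hρ0, zero_mul]) hfδ (Or.inl fun n => ?_)
    · obtain ⟨h1, h2⟩ := hshift hs hρT
      rw [norm_mul]
      calc _ ≤ (5 * q' * (2 * T)) * (5 * (q * q' : ℕ) * (2 * T)) :=
            mul_le_mul (norm_LFunction_le_of_re hcase.1 h1 h2)
              (norm_LFunction_le_of_re hcase.2 h1 h2) (norm_nonneg _) (by positivity)
        _ ≤ (5 * T * (2 * T)) * (5 * (T * T) * (2 * T)) := by push_cast; gcongr
        _ = 100 * T ^ 5 := by ring
    · have h1 := re_logDerivCoeff_add_nonpos hχ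
        (changeLevel_mul_changeLevel_natCast χ χ') n ρ.im
      rw [hfc, logDerivCoeff_comp_const_add (fun z => χ'.LFunction z * ψ.LFunction z), add_zero,
        logDerivCoeff_mul ((differentiable_LFunction hcase.1).analyticAt c)
          ((differentiable_LFunction hcase.2).analyticAt c)
          (LFunction_ne_zero_of_one_lt_re _ (by simp [hcre]))
          (LFunction_ne_zero_of_one_lt_re _ (by simp [hcre]))]
      simp only [Complex.add_re, Complex.one_re] at h1 ⊢
      linarith

end DirichletCharacter

theorem norm_sum_range_smul_le_of_antitone {E : Type*} [SeminormedAddCommGroup E]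
    [NormedSpace ℝ E] {b : ℕ → ℝ} (hb : Antitone b) (hb0 : ∀ i, 0 ≤ b i) {z : ℕ → E} {B : ℝ}
    (hz : ∀ n, ‖∑ i ∈ Finset.range n, z i‖ ≤ B) (n : ℕ) :
    ‖∑ i ∈ Finset.range n, b i • z i‖ ≤ b 0 * B := by
  have hB : 0 ≤ B := by simpa using hz 0
  rw [Finset.sum_range_by_parts]
  calc _ ≤ b (n - 1) * B + ∑ i ∈ Finset.range (n - 1), (b i - b (i + 1)) * B := by
        refine (norm_sub_le _ _).trans (add_le_add ?_ ((norm_sum_le _ _).trans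
          (Finset.sum_le_sum fun i _ => ?_)))
        · rw [norm_smul, Real.norm_of_nonneg (hb0 _)]
          exact mul_le_mul_of_nonneg_left (hz n) (hb0 _)
        · rw [norm_smul, norm_sub_rev, Real.norm_of_nonneg (sub_nonneg.2 (hb i.le_succ))]
          exact mul_le_mul_of_nonneg_left (hz _) (sub_nonneg.2 (hb i.le_succ))
    _ = b 0 * B := by
        rw [← Finset.sum_mul, Finset.sum_range_sub' b]
        ring

theorem sq_mul_pow_le_geom_sum_sq {t : ℝ} (ht : 0 ≤ t) (n : ℕ) :
    (n : ℝ) ^ 2 * t ^ (n - 1) ≤ (∑ i ∈ Finset.range n, t ^ i) ^ 2 := by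
  have h := Finset.sum_sq_le_sum_mul_sum_of_sq_le_mul (Finset.range n)
    (f := fun i => t ^ i) (g := fun i => t ^ (n - 1 - i)) (r := fun _ => √(t ^ (n - 1)))
    (fun i _ => by positivity) (fun i _ => by positivity)
    (fun i hi => by
      rw [Real.sq_sqrt (by positivity), ← pow_add]
      refine le_of_eq (congrArg _ ?_)
      have := Finset.mem_range.1 hi
      omega)
  rw [Finset.sum_range_reflect (fun i => t ^ i) n] at h
  rwa [Finset.sum_const, Finset.card_range, nsmul_eq_mul, mul_pow,
    Real.sq_sqrt (pow_nonneg ht _), ← sq] at h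

theorem antitone_one_div_sub_pow_div_geom_sum {t : ℝ} (ht : 0 < t) (ht' : t ≤ 1) :
    Antitone fun i : ℕ => 1 / ((i : ℝ) + 1) - t ^ (i + 1) / ∑ j ∈ Finset.range (i + 1), t ^ j := by
  refine antitone_nat_of_succ_le fun i => ?_
  have hS : 0 < ∑ j ∈ Finset.range (i + 1), t ^ j :=
    Finset.sum_pos (fun j _ => by positivity) (by simp)
  have hrec : ∑ j ∈ Finset.range (i + 1 + 1), t ^ j =
      t * ∑ j ∈ Finset.range (i + 1), t ^ j + 1 := geom_sum_succ
  have h1 := sq_mul_pow_le_geom_sum_sq ht.le (i + 1)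
  have h2 := sq_mul_pow_le_geom_sum_sq ht.le (i + 1 + 1)
  rw [hrec] at h2 ⊢
  set S := ∑ j ∈ Finset.range (i + 1), t ^ j
  simp only [Nat.add_sub_cancel] at h1 h2
  push_cast at h1 h2 ⊢
  have h3 : ((i + 1 : ℝ) * (i + 1 + 1) * t ^ (i + 1)) ^ 2 ≤ (S * (t * S + 1)) ^ 2 := by
    calc _ = ((i + 1 : ℝ) ^ 2 * t ^ i) * ((i + 1 + 1 : ℝ) ^ 2 * t ^ (i + 1)) * t := by ring
      _ ≤ ((i + 1 : ℝ) ^ 2 * t ^ i) * ((i + 1 + 1 : ℝ) ^ 2 * t ^ (i + 1)) * 1 := by gcongr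
      _ ≤ S ^ 2 * (t * S + 1) ^ 2 * 1 := by gcongr
      _ = _ := by ring
  have h4 := (pow_le_pow_iff_left₀ (by positivity) (by positivity) two_ne_zero).1 h3
  have h5 : 1 / ((i : ℝ) + 1) - 1 / (i + 1 + 1) - (t ^ (i + 1) / S - t ^ (i + 1 + 1) / (t * S + 1))
      = (S * (t * S + 1) - (i + 1 : ℝ) * (i + 1 + 1) * t ^ (i + 1)) /
        ((i + 1) * (i + 1 + 1) * (S * (t * S + 1))) := by
    field_simp
    ring
  have h6 : 0 ≤ (S * (t * S + 1) - (i + 1 : ℝ) * (i + 1 + 1) * t ^ (i + 1)) /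
        ((i + 1) * (i + 1 + 1) * (S * (t * S + 1))) :=
    div_nonneg (by linarith) (by positivity)
  linarith

theorem pow_div_geom_sum_le_one_div {t : ℝ} (ht : 0 < t) (ht' : t ≤ 1) (n : ℕ) :
    t ^ (n + 1) / ∑ j ∈ Finset.range (n + 1), t ^ j ≤ 1 / ((n : ℝ) + 1) := by
  have hS : (n + 1 : ℝ) * t ^ (n + 1) ≤ ∑ j ∈ Finset.range (n + 1), t ^ j := by
    have := Finset.card_nsmul_le_sum (Finset.range (n + 1)) (fun j => t ^ j) (t ^ (n + 1))
      fun j hj => pow_le_pow_of_le_one ht.le ht' (Finset.mem_range.1 hj).le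
    simpa using this
  have h0 : 0 < (n + 1 : ℝ) * t ^ (n + 1) := by positivity
  rw [div_le_div_iff₀ (h0.trans_le hS) (by positivity)]
  linarith

namespace DirichletCharacter

theorem norm_sum_range_le {N : ℕ} [NeZero N] {χ : DirichletCharacter ℂ N} (hχ : χ ≠ 1) (n : ℕ) :
    ‖∑ i ∈ Finset.range n, χ ((i + 1 : ℕ) : ZMod N)‖ ≤ N := by
  have h := norm_sum_Icc_le hχ n
  rwa [Finset.range_eq_Ico, Finset.sum_Ico_add' (fun k : ℕ => χ (k : ZMod N))]

theorem norm_sum_range_shift_le {N : ℕ} [NeZero N] {χ : DirichletCharacter ℂ N} (hχ : χ ≠ 1)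
    (m n : ℕ) : ‖∑ i ∈ Finset.range n, χ ((m + i + 1 : ℕ) : ZMod N)‖ ≤ 2 * N := by
  have h : ∑ i ∈ Finset.range n, χ ((m + i + 1 : ℕ) : ZMod N) =
      ∑ i ∈ Finset.range (m + n), χ ((i + 1 : ℕ) : ZMod N) -
        ∑ i ∈ Finset.range m, χ ((i + 1 : ℕ) : ZMod N) := by
    rw [Finset.sum_range_add, add_sub_cancel_left]
  rw [h]
  linarith [norm_sub_le (∑ i ∈ Finset.range (m + n), χ ((i + 1 : ℕ) : ZMod N))
    (∑ i ∈ Finset.range m, χ ((i + 1 : ℕ) : ZMod N)), norm_sum_range_le hχ (m + n),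
    norm_sum_range_le hχ m]

theorem norm_LFunction_sub_sum_le {N : ℕ} [NeZero N] {χ : DirichletCharacter ℂ N}
    (hχ : χ ≠ 1) {x : ℝ} (hx : 1 < x) (n : ℕ) :
    ‖χ.LFunction x - ∑ i ∈ Finset.range n, χ ((i + 1 : ℕ) : ZMod N) * ((i + 1 : ℕ) : ℂ) ^ (-x : ℂ)‖
      ≤ 1 / ((n : ℝ) + 1) * (2 * N) := by
  have hs : 1 < (x : ℂ).re := by simpa
  have hterm (k : ℕ) : LSeries.term (fun n => χ n) x (k + 1) =
      χ ((k + 1 : ℕ) : ZMod N) * ((k + 1 : ℕ) : ℂ) ^ (-x : ℂ) := by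
    rw [LSeries.term_of_ne_zero k.succ_ne_zero, Complex.cpow_neg, div_eq_mul_inv]
  have h1 := (hasSum_nat_add_iff' (n + 1)).2 (χ.LSeriesSummable_of_one_lt_re hs).LSeriesHasSum
  rw [Finset.sum_range_succ', LSeries.term_zero, add_zero, ← LFunction_eq_LSeries χ hs] at h1
  simp only [hterm] at h1
  refine le_of_tendsto h1.tendsto_sum_nat.norm (Filter.Eventually.of_forall fun m => ?_)
  have h2 := norm_sum_range_smul_le_of_antitone (b := fun i : ℕ => ((n + i + 1 : ℕ) : ℝ) ^ (-x))
    (fun i j hij => Real.rpow_le_rpow_of_nonpos (by positivity) (by gcongr) (by linarith))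
    (fun i => by positivity) (norm_sum_range_shift_le hχ n) m
  refine le_trans (le_of_eq ?_) (h2.trans ?_)
  · congr 1
    refine Finset.sum_congr rfl fun i _ => ?_
    rw [show i + (n + 1) = n + i + 1 by ring, hterm, Complex.real_smul, mul_comm,
      Complex.ofReal_cpow (by positivity)]
    push_cast
    rfl
  · gcongr
    rw [add_zero, Nat.cast_add_one, one_div, ← Real.rpow_neg_one]
    exact Real.rpow_le_rpow_of_exponent_le (by simp) (by linarith)

theorem norm_LFunction_one_sub_sum_le {N : ℕ} [NeZero N] {χ : DirichletCharacter ℂ N}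
    (hχ : χ ≠ 1) (n : ℕ) :
    ‖χ.LFunction 1 - ∑ i ∈ Finset.range n, χ ((i + 1 : ℕ) : ZMod N) * ((i + 1 : ℕ) : ℂ)⁻¹‖
      ≤ 1 / ((n : ℝ) + 1) * (2 * N) := by
  have hcont : Continuous fun x : ℝ => χ.LFunction x -
      ∑ i ∈ Finset.range n, χ ((i + 1 : ℕ) : ZMod N) * ((i + 1 : ℕ) : ℂ) ^ (-x : ℂ) := by
    refine ((differentiable_LFunction hχ).continuous.comp Complex.continuous_ofReal).sub
      (continuous_finsetSum _ fun i _ => continuous_const.mul ?_)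
    exact Complex.continuous_ofReal.neg.const_cpow (Or.inl (by norm_cast))
  have h1 := (hcont.tendsto 1).norm.mono_left (nhdsWithin_le_nhds (s := Set.Ioi 1))
  have h2 := le_of_tendsto h1 (eventually_nhdsWithin_of_forall
    fun x hx => norm_LFunction_sub_sum_le hχ hx n)
  simpa only [Complex.ofReal_one, Complex.cpow_neg_one] using h2

/-- The Dirichlet series of a nontrivial character converges at `1` to the value of `L`. -/
theorem tendsto_sum_LFunction_one {N : ℕ} [NeZero N] {χ : DirichletCharacter ℂ N}
    (hχ : χ ≠ 1) :
    Filter.Tendsto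
      (fun n : ℕ => ∑ i ∈ Finset.range n, χ ((i + 1 : ℕ) : ZMod N) * ((i + 1 : ℕ) : ℂ)⁻¹)
      Filter.atTop (nhds (χ.LFunction 1)) := by
  rw [tendsto_iff_norm_sub_tendsto_zero]
  refine squeeze_zero (fun _ => norm_nonneg _)
    (fun n => (norm_sub_rev _ _).trans_le (norm_LFunction_one_sub_sum_le hχ n)) ?_
  simpa using tendsto_one_div_add_atTop_nhds_zero_nat.mul_const (2 * (N : ℝ))

theorem zetaMul_apply {N : ℕ} (χ : DirichletCharacter ℂ N) (n : ℕ) :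
    zetaMul χ n = ∑ d ∈ n.divisors, χ (d : ZMod N) := by
  rw [zetaMul, ArithmeticFunction.coe_zeta_mul_apply]
  refine Finset.sum_congr rfl fun d hd => ?_
  exact if_neg (Nat.pos_of_mem_divisors hd).ne'

open scoped ComplexOrder in
theorem one_le_zetaMul_sq {N : ℕ} {χ : DirichletCharacter ℂ N} (hχ : χ ^ 2 = 1) {n : ℕ}
    (hn : n ≠ 0) : 1 ≤ zetaMul χ (n ^ 2) := by
  rw [χ.isMultiplicative_zetaMul.multiplicative_factorization _ (pow_ne_zero 2 hn)]
  refine Finset.prod_induction _ (fun z : ℂ => 1 ≤ z) (fun _ _ => one_le_mul_of_one_le_of_one_le)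
    le_rfl fun p hp => ?_
  have hp := Nat.prime_of_mem_primeFactors hp
  rw [Nat.factorization_pow, Finsupp.smul_apply, smul_eq_mul]
  beta_reduce
  rw [zetaMul_apply, Nat.sum_divisors_prime_pow hp]
  simp only [Nat.cast_pow, map_pow]
  rw [Finset.sum_range_succ', pow_zero, le_add_iff_nonneg_left]
  simp only [pow_succ]
  rw [← Finset.sum_mul]
  rcases MulChar.isQuadratic_iff_sq_eq_one.mpr hχ p with h | h | h
  · simp [h]
  · simp only [h, one_pow, mul_one]
    exact Finset.sum_nonneg fun _ _ => zero_le_one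
  · simp [h, neg_one_geom_sum]

theorem hasSum_zetaMul_mul_pow {N : ℕ} (χ : DirichletCharacter ℂ N) {t : ℝ} (ht : 0 < t)
    (ht' : t < 1) :
    ∃ F : ℂ, HasSum (fun n : ℕ+ => zetaMul χ n * (t : ℂ) ^ (n : ℕ)) F ∧
      HasSum (fun n : ℕ+ => χ (n : ℕ) * ((t : ℂ) ^ (n : ℕ) / (1 - (t : ℂ) ^ (n : ℕ)))) F := by
  have htn : ‖(t : ℂ)‖ < 1 := by rwa [Complex.norm_real, Real.norm_of_nonneg ht.le]
  have hsum : Summable fun c : ℕ+ × ℕ+ => χ (c.1 : ℕ) * (t : ℂ) ^ (c.1 * c.2 : ℕ) := by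
    refine Summable.of_norm_bounded (summable_prod_mul_pow 0 htn).norm fun c => ?_
    rw [norm_mul, pow_zero, one_mul]
    exact mul_le_of_le_one_left (norm_nonneg _) (χ.norm_le_one _)
  refine ⟨_, ?_, hsum.hasSum.prod_fiberwise fun n => ?_⟩
  · have h := (sigmaAntidiagonalEquivProd.hasSum_iff (f :=
      fun c : ℕ+ × ℕ+ => χ (c.1 : ℕ) * (t : ℂ) ^ (c.1 * c.2 : ℕ))).2 hsum.hasSum
    have h2 := h.sigma fun n => hasSum_fintype _
    convert h2 using 2 with n
    rw [zetaMul_apply, Finset.sum_mul, Finset.univ_eq_attach]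
    simp only [Function.comp_apply, sigmaAntidiagonalEquivProd, divisorsAntidiagonalFactors,
      Equiv.coe_fn_mk, PNat.mk_coe]
    rw [(n : ℕ).divisorsAntidiagonal.sum_attach
      fun x : ℕ × ℕ => χ (x.1 : ZMod N) * (t : ℂ) ^ (x.1 * x.2),
      Nat.sum_divisorsAntidiagonal fun x y => χ (x : ZMod N) * (t : ℂ) ^ (x * y)]
    exact Finset.sum_congr rfl fun d hd => by rw [Nat.mul_div_cancel' (Nat.dvd_of_mem_divisors hd)]
  · have h1 : ‖(t : ℂ) ^ (n : ℕ)‖ < 1 := by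
      rw [norm_pow]
      exact pow_lt_one₀ (norm_nonneg _) htn n.ne_zero
    have h2 := ((hasSum_geometric_of_norm_lt_one h1).mul_left ((t : ℂ) ^ (n : ℕ))).mul_left
      (χ (n : ℕ))
    rw [← Equiv.pnatEquivNat.hasSum_iff] at h2
    rw [div_eq_mul_inv]
    refine (congrArg (HasSum · _) (funext fun k => ?_)).mpr h2
    change χ (n : ℕ) * (t : ℂ) ^ (n * k : ℕ) = χ (n : ℕ) * ((t : ℂ) ^ (n : ℕ) * _ ^ k.natPred)
    rw [← pow_succ', ← pow_mul, PNat.natPred_add_one]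

theorem norm_LFunction_one_sub_le {N : ℕ} [NeZero N] {χ : DirichletCharacter ℂ N} (hχ : χ ≠ 1)
    {t : ℝ} (ht : 0 < t) (ht' : t < 1) {F : ℂ}
    (hF : HasSum (fun n : ℕ+ => χ (n : ℕ) * ((t : ℂ) ^ (n : ℕ) / (1 - (t : ℂ) ^ (n : ℕ)))) F) :
    ‖χ.LFunction 1 - (1 - t) * F‖ ≤ (1 - t) * N := by
  rw [← Equiv.pnatEquivNat.symm.hasSum_iff] at hF
  have h1 := (tendsto_sum_LFunction_one hχ).sub (hF.tendsto_sum_nat.const_mul (1 - t : ℂ))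
  refine le_of_tendsto h1.norm (Filter.Eventually.of_forall fun n => ?_)
  have h2 := norm_sum_range_smul_le_of_antitone (antitone_one_div_sub_pow_div_geom_sum ht ht'.le)
    (fun i => sub_nonneg.2 (pow_div_geom_sum_le_one_div ht ht'.le i)) (norm_sum_range_le hχ) n
  refine le_of_eq_of_le (congrArg _ ?_) (h2.trans_eq (congrArg (· * (N : ℝ)) ?_))
  · rw [Finset.mul_sum, ← Finset.sum_sub_distrib]
    refine Finset.sum_congr rfl fun i _ => ?_
    have hS : ((∑ j ∈ Finset.range (i + 1), t ^ j : ℝ) : ℂ) ≠ 0 :=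
      Complex.ofReal_ne_zero.2 (Finset.sum_pos (fun j _ => by positivity) (by simp)).ne'
    have hgeom : (1 - (t : ℂ) ^ (i + 1)) = (1 - t) * (∑ j ∈ Finset.range (i + 1), t ^ j : ℝ) := by
      push_cast
      exact (mul_neg_geom_sum _ _).symm
    have ht1 : (1 - t : ℂ) ≠ 0 := by
      rw [← Complex.ofReal_one, ← Complex.ofReal_sub]
      exact Complex.ofReal_ne_zero.2 (by linarith)
    have hi : (i + 1 : ℂ) ≠ 0 := Nat.cast_add_one_ne_zero i
    simp only [Function.comp_apply, Equiv.pnatEquivNat_symm_apply, Nat.succPNat_coe,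
      Nat.succ_eq_add_one, hgeom, Complex.real_smul, Complex.ofReal_sub, Complex.ofReal_div,
      Complex.ofReal_add, Complex.ofReal_one, Complex.ofReal_natCast, Complex.ofReal_pow,
      Nat.cast_add, Nat.cast_one]
    field_simp
  · simp

open scoped ComplexOrder in
theorem mul_pow_sq_le_re {N : ℕ} {χ : DirichletCharacter ℂ N} (hχ : χ ^ 2 = 1) {t : ℝ}
    (ht : 0 < t) (ht' : t < 1) {F : ℂ}
    (hF : HasSum (fun n : ℕ+ => zetaMul χ n * (t : ℂ) ^ (n : ℕ)) F) (K : ℕ) :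
    K * t ^ K ^ 2 ≤ F.re := by
  have h1 := Complex.hasSum_re hF
  have hre (n : ℕ) : (zetaMul χ n * (t : ℂ) ^ n).re = (zetaMul χ n).re * t ^ n := by
    rw [← Complex.ofReal_pow, Complex.re_mul_ofReal]
  simp only [hre] at h1
  have hinj : Function.Injective fun i : ℕ => i.succPNat ^ 2 := fun i j hij =>
    Nat.succPNat_injective (pow_left_injective two_ne_zero hij)
  have h2 := sum_le_hasSum ((Finset.range K).map ⟨_, hinj⟩)
    (fun n _ => mul_nonneg (Complex.nonneg_iff.1 (zetaMul_nonneg hχ n)).1 (by positivity)) h1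
  rw [Finset.sum_map] at h2
  refine le_trans ?_ h2
  have h3 := Finset.card_nsmul_le_sum (Finset.range K)
    (fun i => (zetaMul χ ((i + 1) ^ 2)).re * t ^ (i + 1) ^ 2) (t ^ K ^ 2) fun i hi => by
      have h4 : 1 ≤ (zetaMul χ ((i + 1) ^ 2)).re :=
        (Complex.le_def.1 (one_le_zetaMul_sq hχ i.succ_ne_zero)).1
      have h5 : t ^ K ^ 2 ≤ t ^ (i + 1) ^ 2 :=
        pow_le_pow_of_le_one ht.le ht'.le (Nat.pow_le_pow_left (Finset.mem_range.1 hi) 2)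
      have h6 : 0 < t ^ (i + 1) ^ 2 := by positivity
      nlinarith
  simpa using h3

theorem one_div_le_norm_LFunction_one {N : ℕ} [NeZero N] {χ : DirichletCharacter ℂ N}
    (hχ : χ ≠ 1) (hχ' : ∀ a, (χ a).im = 0) : 1 / (32 * N : ℝ) ≤ ‖χ.LFunction 1‖ := by
  have hN : (1 : ℝ) ≤ N := by exact_mod_cast NeZero.one_le
  have hsq : χ ^ 2 = 1 := by
    rw [sq]
    nth_rewrite 1 [← inv_eq_self_of_im_eq_zero hχ']
    exact inv_mul_cancel χ
  set t : ℝ := 1 - 1 / (32 * N ^ 2) with ht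
  have hN2 : 1 / (32 * N ^ 2 : ℝ) ≤ 1 / 32 := by
    gcongr
    nlinarith
  have hN0 : 0 < 1 / (32 * N ^ 2 : ℝ) := by positivity
  have ht0 : 0 < t := by linarith
  have ht1 : t < 1 := by linarith
  obtain ⟨F, h1, h2⟩ := hasSum_zetaMul_mul_pow χ ht0 ht1
  have h3 := mul_pow_sq_le_re hsq ht0 ht1 h1 (4 * N)
  have h4 := norm_LFunction_one_sub_le hχ ht0 ht1 h2
  have h5 : 1 / 2 ≤ t ^ (4 * N) ^ 2 := by
    have := one_add_mul_le_pow (a := -(1 / (32 * N ^ 2 : ℝ))) (by linarith) ((4 * N) ^ 2)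
    rw [← sub_eq_add_neg, ← ht] at this
    refine le_trans (le_of_eq ?_) this
    push_cast
    field_simp
    norm_num
  have h6 : 2 * (N : ℝ) ≤ ‖F‖ := by
    refine le_trans ?_ (h3.trans (Complex.re_le_norm F))
    push_cast
    nlinarith
  have h7 : ‖(1 - t : ℂ) * F‖ = (1 - t) * ‖F‖ := by
    rw [norm_mul, ← Complex.ofReal_one, ← Complex.ofReal_sub, Complex.norm_real,
      Real.norm_of_nonneg (by linarith)]
  have h8 := norm_sub_norm_le ((1 - t : ℂ) * F) (χ.LFunction 1)
  rw [norm_sub_rev, h7] at h8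
  have h9 : (1 - t) * N = 1 / (32 * N : ℝ) := by
    rw [ht]
    field_simp
    ring
  nlinarith

theorem one_div_le_of_LFunction_eq_zero {N : ℕ} [NeZero N] {χ : DirichletCharacter ℂ N}
    (hχ : χ ≠ 1) (hχ' : ∀ a, (χ a).im = 0) {δ : ℝ} (hδ : 0 < δ) (hδ' : δ ≤ 1 / 10)
    (hzero : χ.LFunction (1 - δ) = 0) : 1 / (400 * N ^ 2 : ℝ) ≤ δ := by
  have hN : (1 : ℝ) ≤ N := by exact_mod_cast NeZero.one_le
  have hderiv (z : ℂ) (hz : z ∈ Metric.ball (1 : ℂ) (1 / 5)) : ‖deriv χ.LFunction z‖ ≤ 12 * N := by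
    rw [mem_ball_iff_norm] at hz
    have := Complex.norm_deriv_le_of_forall_mem_sphere_norm_le (c := z) (R := 1 / 2)
      (C := 6 * N) (by norm_num) (differentiable_LFunction hχ).diffContOnCl fun w hw => by
        rw [mem_sphere_iff_norm] at hw
        have h1 : ‖w - 1‖ ≤ 7 / 10 := by
          refine (norm_sub_le_norm_sub_add_norm_sub w z 1).trans ?_
          linarith
        have h2 : 3 / 10 ≤ w.re := by
          have := (abs_le.1 ((Complex.abs_re_le_norm _).trans h1)).1
          simp at this
          linarith
        have h3 : ‖w‖ ≤ 17 / 10 := by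
          have := norm_sub_norm_le w 1
          rw [norm_one] at this
          linarith
        refine (norm_LFunction_le hχ (by linarith)).trans ?_
        rw [div_le_iff₀ (by linarith)]
        nlinarith
    linarith
  have h1 := (convex_ball (1 : ℂ) (1 / 5)).norm_image_sub_le_of_norm_deriv_le (𝕜 := ℂ)
    (f := χ.LFunction) (fun z _ => differentiable_LFunction hχ z) hderiv
    (x := 1 - δ) (y := 1) (by simp [abs_of_pos hδ]; linarith) (by simp)
  rw [hzero, sub_zero, sub_sub_cancel, Complex.norm_real, Real.norm_of_nonneg hδ.le] at h1
  have h2 := (one_div_le_norm_LFunction_one hχ hχ').trans h1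
  rw [div_le_iff₀ (by positivity)] at h2 ⊢
  nlinarith

end DirichletCharacter

namespace DirichletCharacter

theorem exists_ne_one_of_LFunction_eq_zero :
    ∃ ε : ℝ, 0 < ε ∧ ∀ δ : ℝ, 0 < δ → δ < ε → δ < 1 → ∀ {N : ℕ} [NeZero N]
      {χ : DirichletCharacter ℂ N}, χ.LFunction (1 - δ) = 0 → χ ≠ 1 := by
  have h1 := (differentiable_LFunctionTrivChar₁ 1).continuous.continuousAt.eventually_ne
    (LFunctionTrivChar₁_apply_one_ne_zero (n := 1))
  obtain ⟨ε, hε, h2⟩ := Metric.eventually_nhds_iff.1 h1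
  refine ⟨ε, hε, fun δ hδ hδε hδ1 N _ χ h0 h => ?_⟩
  subst h
  refine h2 (y := 1 - δ) ?_ (LFunctionTrivChar₁_one_eq_zero ?_ ?_ h0)
  · simpa [dist_eq_norm, abs_of_pos hδ] using hδε
  · simpa using hδ1
  · simp [hδ.ne']

theorem one_le_mul_exp_of_LFunction_zeros {q q' : ℕ} [NeZero q] [NeZero q']
    {χ : DirichletCharacter ℂ q} {χ' : DirichletCharacter ℂ q'} {T δ : ℝ} (hT : 1600 ≤ T)
    (hq : (q : ℝ) ≤ T) (hq' : (q' : ℝ) ≤ T) (hχ : ∀ a, (χ a).im = 0) (hχ1 : χ ≠ 1) (hδ : 0 < δ)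
    (hδ' : δ ≤ 1 / 10) (hzero : χ.LFunction (1 - δ) = 0) {ρ : ℂ} (hρ : 1 / 2 ≤ ρ.re)
    (hρ' : ρ.re < 1) (hρT : |ρ.im| ≤ T) (hρ0 : χ'.LFunction ρ = 0) (hne : ρ ≠ 1 - δ) :
    1 ≤ 32 * 10 ^ 7 * (δ * Real.log T) * Real.exp (10 ^ 7 * Real.log T * (1 - ρ.re)) := by
  obtain ⟨W, hW1, hW2, hW3⟩ := exists_multiset_of_LFunction_zeros hT hq hq' hχ hχ1 hδ hδ' hzero
    hρ hρ' hρT hρ0 hne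
  have hL : 1 ≤ Real.log T := by
    rw [Real.le_log_iff_exp_le (by linarith)]
    linarith [Real.exp_one_lt_d9]
  have hJ1 := Nat.le_ceil (7 * 10 ^ 6 * Real.log T)
  have hJ2 := (Nat.ceil_lt_add_one (by positivity : 0 ≤ 7 * 10 ^ 6 * Real.log T)).le
  set J := ⌈7 * 10 ^ 6 * Real.log T⌉₊
  have hJ3 : (J : ℝ) ≤ 10 ^ 7 * Real.log T := by linarith
  have h := one_le_mul_exp_of_re_power_sum_le hδ.le (by positivity) hρ' hρ hW2 hW3
    (J := J) (Nat.cast_pos.1 (lt_of_lt_of_le (by positivity) hJ1)) (by linarith)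
  calc (1 : ℝ) ≤ _ := h
    _ ≤ 32 * (10 ^ 7 * Real.log T) * δ * Real.exp (10 ^ 7 * Real.log T * (1 - ρ.re)) := by
        gcongr
    _ = _ := by ring

end DirichletCharacter

/-- Linnik's repulsion (Deuring–Heilbronn) phenomenon (1.4): there are
effectively computable `a₀ > 0` and `T₀ > 0` such that for all `T ≥ T₀`, if some real
primitive character `χ_T` of modulus `q ≤ T` is real-valued and its L-function has a real
nontrivial zero `β_T ≥ 1 − a₀/log T` (the `T`-exceptional zero), then every nontrivial zero
`ρ = β + iγ ≠ β_T`, `|γ| ≤ T`, of any Dirichlet L-function of a primitive character of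
modulus `q' ≤ T` satisfies `β ≤ 1 − (a₀/log T)·log(a₀ e /((1 − β_T) log T))`. -/
theorem linnik_repulsion :
    ∃ a₀ : ℝ, 0 < a₀ ∧ ∃ T₀ : ℝ, 0 < T₀ ∧ ∀ T : ℝ, T₀ ≤ T →
      ∀ (q : ℕ) [NeZero q] (χ : DirichletCharacter ℂ q),
        χ.IsPrimitive → (q : ℝ) ≤ T → (∀ a : ZMod q, (χ a).im = 0) →
        ∀ β_T : ℝ, 0 < β_T → β_T < 1 → χ.LFunction (β_T : ℂ) = 0 →
          1 - a₀ / Real.log T ≤ β_T →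
          ∀ (q' : ℕ) [NeZero q'] (χ' : DirichletCharacter ℂ q') (ρ : ℂ),
            χ'.IsPrimitive → (q' : ℝ) ≤ T → 0 < ρ.re → ρ.re < 1 → |ρ.im| ≤ T →
            χ'.LFunction ρ = 0 → ρ ≠ (β_T : ℂ) →
            ρ.re ≤ 1 - (a₀ / Real.log T) *
              Real.log (a₀ * Real.exp 1 / ((1 - β_T) * Real.log T)) := by
  obtain ⟨ε, hε, hne1⟩ := DirichletCharacter.exists_ne_one_of_LFunction_eq_zero
  refine ⟨1 / 10 ^ 9, by positivity, max 1600 (Real.exp (1 / ε)), by positivity, ?_⟩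
  intro T hT q _ χ _ hq hχ β hβ0 hβ1 hzero hβ q' _ χ' ρ _ hq' hρ0 hρ1 hρT hρ hne
  obtain ⟨hT1, hT2⟩ := max_le_iff.1 hT
  have hL : 1 ≤ Real.log T := by
    rw [Real.le_log_iff_exp_le (by linarith)]
    linarith [Real.exp_one_lt_d9]
  have hLε : 1 / ε ≤ Real.log T := (Real.le_log_iff_exp_le (by linarith)).2 hT2
  obtain ⟨δ, rfl⟩ : ∃ δ, β = 1 - δ := ⟨1 - β, by ring⟩
  rw [sub_sub_cancel]
  push_cast at hzero hne
  have hδ : 0 < δ := by linarith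
  have hδL : δ ≤ 1 / 10 ^ 9 / Real.log T := by linarith
  rw [le_div_iff₀ (by linarith)] at hδL
  rw [div_le_iff₀ hε] at hLε
  have hχ1 : χ ≠ 1 := hne1 δ hδ (by nlinarith) (by linarith) hzero
  have hδ' : δ ≤ 1 / 10 := by nlinarith
  have hδL0 : 0 < δ * Real.log T := by positivity
  have he := Real.exp_one_lt_d9
  suffices Real.log (1 / 10 ^ 9 * Real.exp 1 / (δ * Real.log T)) ≤
      10 ^ 7 * Real.log T * (1 - ρ.re) by
    have h1 : 1 / 10 ^ 9 / Real.log T * Real.log (1 / 10 ^ 9 * Real.exp 1 / (δ * Real.log T)) ≤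
        1 / 10 ^ 9 / Real.log T * (10 ^ 7 * Real.log T * (1 - ρ.re)) := by gcongr
    have h2 : 1 / 10 ^ 9 / Real.log T * (10 ^ 7 * Real.log T * (1 - ρ.re)) =
        1 / 100 * (1 - ρ.re) := by
      field_simp
      ring
    linarith
  rw [Real.log_le_iff_le_exp (by positivity), div_le_iff₀ hδL0]
  rcases le_or_gt (1 / 2) ρ.re with hρ2 | hρ2
  · have := DirichletCharacter.one_le_mul_exp_of_LFunction_zeros hT1 hq hq' hχ hχ1 hδ hδ' hzero hρ2 hρ1 hρT hρ hne
    generalize Real.exp (10 ^ 7 * Real.log T * (1 - ρ.re)) = E at this ⊢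
    generalize δ * Real.log T = x at this ⊢
    norm_num at this ⊢
    linarith
  · have h1 := DirichletCharacter.one_div_le_of_LFunction_eq_zero hχ1 hχ hδ hδ' hzero
    have hq0 : (0 : ℝ) < q := by exact_mod_cast NeZero.pos q
    have h2 : T ^ 2 ≤ Real.exp (10 ^ 7 * Real.log T * (1 - ρ.re)) := by
      rw [← Real.log_le_iff_le_exp (by positivity), Real.log_pow]
      push_cast
      nlinarith
    have h3 : 1 / (400 * T ^ 2) ≤ δ * Real.log T := by
      refine le_trans ?_ (h1.trans (le_mul_of_one_le_right hδ.le hL))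
      gcongr
    have h4 : 1 / 400 ≤ T ^ 2 * (δ * Real.log T) := by
      rw [div_le_iff₀ (by positivity)] at h3
      linarith
    calc _ ≤ (1 / 400 : ℝ) := by linarith
      _ ≤ _ := h4.trans (by gcongr)
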